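/- arXiv:1801.08765 — 3 statements merged into one kernel-verified Lean document; each statement's English description precedes it below -/
import Mathlib

section
/- (Lindemann's theorem). If a is a nonzero complex number algebraic over ℚ, then exp(a) is transcendental over ℚ. -/
namespace LindemannWeierstrass

open Polynomial
open scoped Nat

/-- If `d * x` is integral, then so is `d ^ m * g(x)` for every integer polynomial `g` of degree at
most `m`. -/
theorem isIntegral_pow_mul_aeval {K : Type*} [Field K] {d : ℤ} {x : K}
    (hx : IsIntegral ℤ (d * x : K)) {g : ℤ[X]} {m : ℕ} (hg : g.natDegree ≤ m) :
    IsIntegral ℤ ((d : K) ^ m * aeval x g) := by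
  rw [aeval_eq_sum_range' (Nat.lt_succ_of_le hg), Finset.mul_sum]
  refine IsIntegral.sum _ fun i hi ↦ ?_
  have hi : i ≤ m := Nat.lt_succ_iff.mp (Finset.mem_range.mp hi)
  have : (d : K) ^ m * g.coeff i • x ^ i = ((d ^ (m - i) * g.coeff i : ℤ) : K) * (d * x) ^ i := by
    rw [← Nat.sub_add_cancel hi, pow_add, zsmul_eq_mul]
    push_cast
    rw [Nat.add_sub_cancel]
    ring
  rw [this]
  exact (isIntegral_algebraMap (R := ℤ) (A := K)).mul (hx.pow i)

/-- A Galois-invariant algebraic integer of a Galois number field is a rational integer. -/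
theorem exists_intCast_eq_of_forall_fixed {K : Type*} [Field K] [NumberField K] [IsGalois ℚ K]
    {x : K} (hx : IsIntegral ℤ x) (hfix : ∀ σ : Gal(K/ℚ), σ x = x) : ∃ n : ℤ, (n : K) = x := by
  obtain ⟨q, rfl⟩ := (IsGalois.mem_range_algebraMap_iff_fixed x).mpr hfix
  rw [isIntegral_algebraMap_iff (algebraMap ℚ K).injective, IsIntegrallyClosed.isIntegral_iff] at hx
  obtain ⟨n, rfl⟩ := hx
  exact ⟨n, by simp⟩

/-- A finite set of nonzero elements of a number field consists of roots of an integer polynomial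
that does not vanish at `0`. -/
theorem exists_eval_zero_ne_zero_and_forall_aeval_eq_zero {K : Type*} [Field K] [NumberField K]
    (S : Finset K) (hS : 0 ∉ S) : ∃ f : ℤ[X], f.eval 0 ≠ 0 ∧ ∀ v ∈ S, aeval v f = 0 := by
  have (v : K) (hv : v ≠ 0) : ∃ f : ℤ[X], f.eval 0 ≠ 0 ∧ aeval v f = 0 := by
    have hv' : IsAlgebraic ℤ v :=
      (IsFractionRing.isAlgebraic_iff ℤ ℚ K).mpr (Algebra.IsAlgebraic.isAlgebraic v)
    obtain ⟨f, h0, hf⟩ := hv'.exists_nonzero_coeff_and_aeval_eq_zero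
      (mem_nonZeroDivisors_of_ne_zero hv)
    exact ⟨f, by rwa [← coeff_zero_eq_eval_zero], hf⟩
  choose! f hf0 hf using this
  refine ⟨∏ v ∈ S, f v, ?_, fun v hv ↦ ?_⟩
  · rw [eval_prod, Finset.prod_ne_zero_iff]
    exact fun v hv ↦ hf0 v (ne_of_mem_of_not_mem hv hS)
  · rw [map_prod]
    exact Finset.prod_eq_zero hv (hf v (ne_of_mem_of_not_mem hv hS))

/-- The algebra homomorphism sending a formal sum `∑ n_v [v]` to `∑ n_v * exp (ι v)`. -/
noncomputable def expEval {K : Type*} [Ring K] (ι : K →+* ℂ) : AddMonoidAlgebra ℤ K →ₐ[ℤ] ℂ :=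
  AddMonoidAlgebra.lift ℤ ℂ K (Complex.expMonoidHom.comp ι.toAddMonoidHom.toMultiplicative)

theorem expEval_apply {K : Type*} [Ring K] (ι : K →+* ℂ) (F : AddMonoidAlgebra ℤ K) :
    expEval ι F = F.coeff.sum fun v n ↦ n * Complex.exp (ι v) := by
  simp [expEval, AddMonoidAlgebra.lift_apply', Complex.expMonoidHom]

open Filter Topology in
/-- A Galois-invariant formal sum with nonzero coefficient at `0` has nonzero exponential value. -/
theorem expEval_ne_zero_of_coeff_zero_ne_zero {K : Type*} [Field K] [NumberField K] [IsGalois ℚ K]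
    (ι : K →+* ℂ) {F : AddMonoidAlgebra ℤ K} (h0 : F.coeff 0 ≠ 0)
    (hF : ∀ (σ : Gal(K/ℚ)) v, F.coeff (σ v) = F.coeff v) : expEval ι F ≠ 0 := by
  classical
  intro heval
  set k := F.coeff 0
  set S := F.coeff.support.erase 0
  have hsum : (k : ℂ) + ∑ v ∈ S, F.coeff v * Complex.exp (ι v) = 0 := by
    rw [← heval, expEval_apply, Finsupp.sum,
      ← Finset.add_sum_erase _ _ (Finsupp.mem_support_iff.mpr h0)]
    simp [k, S]
  obtain ⟨f, hf0, hfS⟩ := exists_eval_zero_ne_zero_and_forall_aeval_eq_zero S (by simp [S])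
  have hfne : f ≠ 0 := fun h ↦ hf0 (by simp [h])
  set d := f.leadingCoeff
  have hd : d ≠ 0 := leadingCoeff_ne_zero.mpr hfne
  set m := f.natDegree
  obtain ⟨c, hc⟩ := LindemannWeierstrass.exp_polynomial_approx f hf0
  set A := ∑ v ∈ S, |(F.coeff v : ℝ)|
  set B := |(d : ℝ)| ^ m * c
  have hlim : Tendsto (fun n : ℕ ↦ A * (B * (B ^ n / n !))) atTop (𝓝 0) := by
    simpa using ((FloorSemiring.tendsto_pow_div_factorial_atTop B).const_mul B).const_mul A
  obtain ⟨N, hN⟩ := eventually_atTop.mp (hlim.eventually_lt_const one_pos)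
  obtain ⟨p, hp, hprime⟩ := Nat.exists_infinite_primes
    ((f.eval 0).natAbs + d.natAbs + k.natAbs + N + 1)
  obtain ⟨n, hn, g, hg, happrox⟩ := hc p (by lia) hprime
  have hpZ : Prime (p : ℤ) := Nat.prime_iff_prime_int.mp hprime
  have not_dvd {z : ℤ} (hz : z ≠ 0) (hzp : z.natAbs < p) : ¬ (p : ℤ) ∣ z := fun h ↦
    hzp.not_ge (Nat.le_of_dvd (Int.natAbs_pos.mpr hz) (Int.natCast_dvd.mp h))
  obtain ⟨M, hM⟩ : ∃ M : ℤ, (M : K) = (d : K) ^ (p * m) * ∑ v ∈ S, F.coeff v * aeval v g := by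
    refine exists_intCast_eq_of_forall_fixed ?_ fun σ ↦ ?_
    · rw [Finset.mul_sum]
      refine IsIntegral.sum _ fun v hv ↦ ?_
      rw [mul_left_comm]
      refine (isIntegral_algebraMap (R := ℤ) (A := K)).mul
        (isIntegral_pow_mul_aeval ?_ (hg.trans (Nat.sub_le _ _)))
      simpa using isIntegral_leadingCoeff_smul f v (hfS v hv)
    · rw [map_mul, map_pow, map_intCast, map_sum]
      congr 1
      refine Finset.sum_equiv σ.toEquiv (fun v ↦ by simp [S, hF]) fun v hv ↦ ?_
      simp only [map_mul, map_intCast, AlgEquiv.toEquiv_eq_coe, EquivLike.coe_coe, hF]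
      rw [← AlgEquiv.restrictScalars_apply ℤ, ← Polynomial.aeval_algHom_apply]
      simp
  have key : ((d ^ (p * m) * (n * k) + p * M : ℤ) : ℂ) =
      -((d : ℂ) ^ (p * m) * ∑ v ∈ S, F.coeff v * (n • Complex.exp (ι v) - p • aeval (ι v) g)) := by
    have hM' : (M : ℂ) = (d : ℂ) ^ (p * m) * ∑ v ∈ S, F.coeff v * aeval (ι v) g := by
      have := congrArg ι hM
      simp only [map_mul, map_pow, map_intCast, map_sum] at this
      rw [this]
      congr! 3 with v hv
      exact (Polynomial.aeval_algHom_apply ι.toIntAlgHom v g).symm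
    simp only [zsmul_eq_mul, nsmul_eq_mul, mul_sub, Finset.sum_sub_distrib,
      mul_left_comm _ (n : ℂ), mul_left_comm _ (p : ℂ), ← Finset.mul_sum]
    push_cast
    rw [hM']
    linear_combination (d : ℂ) ^ (p * m) * n * hsum
  have hne : d ^ (p * m) * (n * k) + p * M ≠ 0 := by
    intro h
    have : (p : ℤ) ∣ d ^ (p * m) * (n * k) :=
      (dvd_add_left (dvd_mul_right (p : ℤ) M)).mp (h ▸ dvd_zero _)
    rcases hpZ.dvd_or_dvd this with h | h
    · exact not_dvd hd (by lia) (hpZ.dvd_of_dvd_pow h)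
    · exact (hpZ.dvd_or_dvd h).elim hn (not_dvd h0 (by lia))
  have hge : (1 : ℝ) ≤ ‖((d ^ (p * m) * (n * k) + p * M : ℤ) : ℂ)‖ := by
    rw [Complex.norm_intCast]
    exact_mod_cast Int.one_le_abs hne
  have hle : ‖((d ^ (p * m) * (n * k) + p * M : ℤ) : ℂ)‖ ≤
      A * (B * (B ^ (p - 1) / (p - 1)!)) := by
    rw [key, norm_neg, norm_mul, norm_pow, Complex.norm_intCast]
    calc |(d : ℝ)| ^ (p * m) * ‖∑ v ∈ S, F.coeff v *
          (n • Complex.exp (ι v) - p • aeval (ι v) g)‖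
        ≤ |(d : ℝ)| ^ (p * m) * ∑ v ∈ S, |(F.coeff v : ℝ)| * (c ^ p / (p - 1)!) := by
          gcongr
          refine norm_sum_le_of_le _ fun v hv ↦ ?_
          rw [norm_mul, Complex.norm_intCast]
          gcongr
          refine happrox ((mem_aroots.mpr ⟨hfne, ?_⟩))
          exact (Polynomial.aeval_algHom_apply ι.toIntAlgHom v f).trans (by rw [hfS v hv, map_zero])
      _ = A * (B * (B ^ (p - 1) / (p - 1)!)) := by
          have hB : B * B ^ (p - 1) = |(d : ℝ)| ^ (p * m) * c ^ p := by
            rw [mul_pow_sub_one hprime.ne_zero, mul_pow, ← pow_mul, mul_comm m p]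
          rw [← Finset.sum_mul, ← mul_div_assoc B, hB]
          ring
  exact (hge.trans hle).not_gt (hN (p - 1) (by lia))

/-- A nonzero Galois-invariant formal sum has nonzero exponential value. -/
theorem expEval_ne_zero_of_fixed {K : Type*} [Field K] [NumberField K] [IsGalois ℚ K]
    (ι : K →+* ℂ) {F : AddMonoidAlgebra ℤ K} (h0 : F ≠ 0)
    (hF : ∀ (σ : Gal(K/ℚ)) v, F.coeff (σ v) = F.coeff v) : expEval ι F ≠ 0 := by
  obtain ⟨w, hw⟩ : ∃ w, F.coeff w ≠ 0 := by
    contrapose! h0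
    ext v
    simp [h0]
  have hcoeff (v : K) : (F * ∑ τ : Gal(K/ℚ), .single (-τ w) 1).coeff v =
      ∑ τ : Gal(K/ℚ), F.coeff (v + τ w) := by
    simp [Finset.mul_sum]
  have := expEval_ne_zero_of_coeff_zero_ne_zero ι (F := F * ∑ τ : Gal(K/ℚ), .single (-τ w) 1)
    (by simpa [hcoeff, hF] using hw) fun σ v ↦ by
      rw [hcoeff, hcoeff, ← Equiv.sum_comp (Equiv.mulLeft σ)]
      simp [← map_add, hF]
  exact left_ne_zero_of_mul (map_mul (expEval ι) _ _ ▸ this)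

/-- Exponentials of distinct elements of a Galois number field are linearly independent over `ℤ`. -/
theorem expEval_injective {K : Type*} [Field K] [NumberField K] [IsGalois ℚ K]
    (ι : K →+* ℂ) : Function.Injective (expEval ι) := by
  rw [injective_iff_map_eq_zero]
  intro F hF
  by_contra h0
  let act (σ : Gal(K/ℚ)) := AddMonoidAlgebra.domCongr ℤ ℤ (σ : K ≃+ K)
  have hact (σ τ : Gal(K/ℚ)) : act σ (act τ F) = act (σ * τ) F := by
    ext v
    simp only [act, AddMonoidAlgebra.coeff_domCongr]
    rfl
  refine expEval_ne_zero_of_fixed ι (F := ∏ τ, act τ F) ?_ (fun σ v ↦ ?_) ?_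
  · exact Finset.prod_ne_zero_iff.mpr fun τ _ ↦ by simpa
  · have hfix : act σ (∏ τ, act τ F) = ∏ τ, act τ F := by
      rw [map_prod, ← Equiv.prod_comp (Equiv.mulLeft σ) fun τ ↦ act τ F]
      simp [hact]
    generalize ∏ τ, act τ F = G at hfix
    nth_rw 1 [← hfix]
    simp [act]
  · rw [map_prod]
    refine Finset.prod_eq_zero (Finset.mem_univ 1) ?_
    convert hF
    ext v
    simp only [act, AddMonoidAlgebra.coeff_domCongr]
    rfl

/-- Every algebraic complex number lies in a subfield of `ℂ` that is a finite Galois extension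
of `ℚ`. -/
theorem exists_isGalois_intermediateField_mem {a : ℂ} (ha : IsAlgebraic ℚ a) :
    ∃ K : IntermediateField ℚ ℂ, a ∈ K ∧ NumberField K ∧ IsGalois ℚ K := by
  let p := minpoly ℚ a
  have hp : p ≠ 0 := minpoly.ne_zero ha.isIntegral
  let K := IntermediateField.adjoin ℚ (p.rootSet ℂ)
  have : p.IsSplittingField ℚ K :=
    IntermediateField.adjoin_rootSet_isSplittingField (IsAlgClosed.splits _)
  have : FiniteDimensional ℚ K := IsSplittingField.finiteDimensional K p
  have : Normal ℚ K := Normal.of_isSplittingField p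
  exact ⟨K, IntermediateField.subset_adjoin _ _ (mem_rootSet.mpr ⟨hp, minpoly.aeval ℚ a⟩),
    ⟨⟩, ⟨⟩⟩

end LindemannWeierstrass

open Polynomial LindemannWeierstrass in
/-- **Lindemann's theorem.** If `a` is a nonzero complex number algebraic over `ℚ`,
then `exp a` is transcendental over `ℚ`. -/
theorem lindemann (a : ℂ) (ha0 : a ≠ 0) (halg : IsAlgebraic ℚ a) :
    Transcendental ℚ (Complex.exp a) := by
  obtain ⟨K, haK, _, _⟩ := exists_isGalois_intermediateField_mem halg
  intro h
  obtain ⟨p, hp0, hp⟩ := (IsFractionRing.isAlgebraic_iff ℤ ℚ ℂ).mpr h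
  let b : K := ⟨a, haK⟩
  have hb : Function.Injective fun n : ℕ ↦ n • b :=
    injective_nsmul_iff_not_isOfFinAddOrder.mpr (not_isOfFinAddOrder_of_isAddTorsionFree
      fun h ↦ ha0 (congrArg Subtype.val h))
  let F : AddMonoidAlgebra ℤ K := .mapDomain (fun n : ℕ ↦ n • b) p.toFinsupp
  have hF : F ≠ 0 := by
    refine fun h ↦ hp0 (Polynomial.toFinsupp_injective
      (AddMonoidAlgebra.mapDomain_injective hb ?_))
    simpa [F] using h
  refine hF (expEval_injective (algebraMap K ℂ) ?_)
  rw [map_zero, ← hp, aeval_def, eval₂_eq_sum, Polynomial.sum, expEval_apply]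
  rw [AddMonoidAlgebra.coeff_mapDomain, Finsupp.sum_mapDomain_index (by simp) (by simp [add_mul])]
  simp [Finsupp.sum, Complex.exp_nat_mul]
  rfl
end

section
/- (SC implies SC with parameters). Assume Schanuel's conjecture (SC). Then for every n and every ideal I of ℂ[X₁,…,X_{2n}] such that the Krull dimension of the quotient ring ℂ[X₁,…,X_{2n}]/I is strictly less than n, there exist l ∈ ℕ and complex numbers b₁,…,b_l such that: for all a₁,…,aₙ ∈ ℂ, if every polynomial in I vanishes at the point (a₁, exp a₁, a₂, exp a₂, …, aₙ, exp aₙ), then there exist integers m₁,…,m_{n+l}, with m₁,…,mₙ not all zero, such that Σ_{i=1}^{n} mᵢ aᵢ + Σ_{i=1}^{l} m_{n+i} bᵢ = 0. -/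
set_option maxHeartbeats 1000000
set_option synthInstance.maxHeartbeats 400000

/-- Transcendence degree of an algebra extension. -/
noncomputable def trdeg (F E : Type*) [CommRing F] [CommRing E] [Algebra F E] : Cardinal :=
  ⨆ s : { s : Set E // AlgebraicIndependent F ((↑) : s → E) }, Cardinal.mk s.1

/-- Schanuel's conjecture: for all `ℚ`-linearly independent complex numbers
`a₁,…,aₙ`, the transcendence degree of `ℚ(a₁, exp a₁, …, aₙ, exp aₙ)` over `ℚ`
is at least `n`. -/
def SchanuelConjecture : Prop :=
  ∀ (n : ℕ) (a : Fin n → ℂ), LinearIndependent ℚ a →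
    (n : Cardinal) ≤ trdeg ℚ (IntermediateField.adjoin ℚ
      (Set.range a ∪ Set.range fun i => Complex.exp (a i)))

/-- The point `(a₁, exp a₁, a₂, exp a₂, …, aₙ, exp aₙ) ∈ ℂ^{2n}`. -/
noncomputable def expPoint {n : ℕ} (a : Fin n → ℂ) : Fin (2 * n) → ℂ :=
  fun j =>
    if j.val % 2 = 0 then a ⟨j.val / 2, by have := j.isLt; omega⟩
    else Complex.exp (a ⟨j.val / 2, by have := j.isLt; omega⟩)

theorem ringKrullDim_le_of_isIntegral (R S : Type*) [CommRing R] [CommRing S] [Algebra R S]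
    [Algebra.IsIntegral R S] [FaithfulSMul R S] : ringKrullDim R ≤ ringKrullDim S := by
  refine iSup_le fun p ↦ ?_
  obtain ⟨⟨Q, _, _⟩⟩ := Ideal.nonempty_primesOver (S := S) p.head.asIdeal
  obtain ⟨q, hq, -⟩ := Ideal.exists_ltSeries_of_hasGoingUp p Q
  exact hq ▸ Order.LTSeries.length_le_krullDim q

theorem ringKrullDim_le_of_faithfullyFlat (R S : Type*) [CommRing R] [CommRing S] [Algebra R S]
    [Module.FaithfullyFlat R S] : ringKrullDim R ≤ ringKrullDim S := by
  refine iSup_le fun p ↦ ?_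
  obtain ⟨Q, hQ⟩ := PrimeSpectrum.comap_surjective_of_faithfullyFlat (B := S) p.last
  have : Q.asIdeal.LiesOver p.last.asIdeal := ⟨by rw [← hQ]; rfl⟩
  obtain ⟨q, hq, -⟩ := Ideal.exists_ltSeries_of_hasGoingDown p Q.asIdeal
  exact hq ▸ Order.LTSeries.length_le_krullDim q

theorem exists_natCast_eq_trdeg_and_le_ringKrullDim (k A : Type*) [Field k] [CommRing A]
    [IsDomain A] [Algebra k A] [Algebra.FiniteType k A] :
    ∃ s : ℕ, Algebra.trdeg k A = s ∧ (s : WithBot ℕ∞) ≤ ringKrullDim A := by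
  obtain ⟨s, g, hg, hint⟩ := exists_integral_inj_algHom_of_fg k A
  let _ : Algebra (MvPolynomial (Fin s) k) A := g.toRingHom.toAlgebra
  have : IsScalarTower k (MvPolynomial (Fin s) k) A :=
    .of_algebraMap_eq fun x ↦ (g.commutes x).symm
  have : Algebra.IsIntegral (MvPolynomial (Fin s) k) A := ⟨hint⟩
  have : FaithfulSMul (MvPolynomial (Fin s) k) A :=
    (faithfulSMul_iff_algebraMap_injective _ _).mpr hg
  refine ⟨s, ?_, ?_⟩
  · have h := lift_trdeg_add_eq k (MvPolynomial (Fin s) k) A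
    simpa [trdeg_eq_zero] using h.symm
  · refine le_trans ?_ (ringKrullDim_le_of_isIntegral (MvPolynomial (Fin s) k) A)
    rw [MvPolynomial.ringKrullDim_of_isNoetherianRing, ringKrullDim_eq_zero_of_field]
    simp

/-- If the coordinates of `x : σ → K` satisfy the equations generating `I`, all of which have
coefficients in the subfield `k`, then `dim k[x] ≤ dim K[X]/I`. -/
theorem ringKrullDim_adjoin_range_le {k K σ : Type*} [Field k] [Field K] [Algebra k K]
    (G : Set (MvPolynomial σ k)) (x : σ → K) (hx : ∀ g ∈ G, MvPolynomial.aeval x g = 0) :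
    ringKrullDim (Algebra.adjoin k (Set.range x)) ≤
      ringKrullDim (MvPolynomial σ K ⧸
        Ideal.span (MvPolynomial.map (algebraMap k K) '' G)) := by
  set A := Algebra.adjoin k (Set.range x)
  let y : σ → A := fun i ↦ ⟨x i, Algebra.subset_adjoin ⟨i, rfl⟩⟩
  have hxy (p : MvPolynomial σ k) : (MvPolynomial.aeval y p : K) = MvPolynomial.aeval x p := by
    exact ((MvPolynomial.comp_aeval_apply y A.val p).trans rfl :)
  let f : MvPolynomial σ K →+* TensorProduct k A K := MvPolynomial.eval₂Hom
    (Algebra.TensorProduct.includeRight (R := k) (A := A) (B := K)).toRingHom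
    fun i ↦ y i ⊗ₜ[k] 1
  have hf_X (i : σ) : f (MvPolynomial.X i) = y i ⊗ₜ[k] 1 := by simp [f]
  have hf (p : MvPolynomial σ k) :
      f (MvPolynomial.map (algebraMap k K) p) = MvPolynomial.aeval y p ⊗ₜ[k] 1 := by
    induction p using MvPolynomial.induction_on with
    | C c => simp [f, Algebra.TensorProduct.algebraMap_apply]
    | add p q hp hq => simp [hp, hq, TensorProduct.add_tmul]
    | mul_X p i hp => simp [hp, hf_X]
  have hf_surj : Function.Surjective f := by
    intro z
    induction z with
    | zero => exact ⟨0, map_zero f⟩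
    | add z w hz hw =>
      obtain ⟨p, rfl⟩ := hz
      obtain ⟨q, rfl⟩ := hw
      exact ⟨p + q, map_add f p q⟩
    | tmul a c =>
      obtain ⟨p, hp⟩ : ∃ p : MvPolynomial σ k, MvPolynomial.aeval x p = a := by
        have h : (a : K) ∈ Algebra.adjoin k (Set.range x) := a.2
        rwa [Algebra.adjoin_range_eq_range_aeval] at h
      refine ⟨MvPolynomial.C c * MvPolynomial.map (algebraMap k K) p, ?_⟩
      rw [map_mul, hf, Subtype.ext ((hxy p).trans hp)]
      simp [f]
  have hker : ∀ p ∈ Ideal.span (MvPolynomial.map (algebraMap k K) '' G), f p = 0 := by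
    intro p hp
    suffices h : Ideal.span (MvPolynomial.map (algebraMap k K) '' G) ≤ RingHom.ker f from h hp
    rw [Ideal.span_le]
    rintro _ ⟨g, hg, rfl⟩
    have : MvPolynomial.aeval y g = 0 := Subtype.ext ((hxy g).trans (hx g hg))
    simp [hf, this]
  exact (ringKrullDim_le_of_faithfullyFlat A (TensorProduct k A K)).trans
    (ringKrullDim_le_of_surjective (Ideal.Quotient.lift _ f hker)
      (Ideal.Quotient.lift_surjective_of_surjective _ hker hf_surj))

theorem linearIndependent_append {n l : ℕ} {a : Fin n → ℂ} {b : Fin l → ℂ}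
    (hb : LinearIndependent ℚ b)
    (h : ∀ (m : Fin n → ℤ) (m' : Fin l → ℤ),
      (∑ i, m i • a i) + (∑ i, m' i • b i) = 0 → m = 0) :
    LinearIndependent ℚ (Fin.append a b) := by
  rw [← LinearIndependent.iff_fractionRing ℤ ℚ] at hb ⊢
  rw [Fintype.linearIndependent_iff] at hb ⊢
  intro g hg
  simp only [Fin.sum_univ_add, Fin.append_left, Fin.append_right] at hg
  have h0 := h _ _ hg
  have h1 := hb (fun i ↦ g (Fin.natAdd n i)) (by
    simpa [funext_iff.mp h0] using hg)
  intro i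
  induction i using Fin.addCases with
  | left i => exact congr_fun h0 i
  | right i => exact h1 i

theorem range_expPoint {n : ℕ} (a : Fin n → ℂ) :
    Set.range (expPoint a) = Set.range a ∪ Set.range fun i ↦ Complex.exp (a i) := by
  ext z
  constructor
  · rintro ⟨j, rfl⟩
    unfold expPoint
    split_ifs
    exacts [.inl ⟨_, rfl⟩, .inr ⟨_, rfl⟩]
  · rintro (⟨i, rfl⟩ | ⟨i, rfl⟩)
    · exact ⟨⟨2 * i, by omega⟩, by simp [expPoint]⟩
    · exact ⟨⟨2 * i + 1, by omega⟩, by simp [expPoint, Nat.add_mod, Nat.mul_add_div]⟩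

/-- The transcendence degree of an intermediate field over the base field. -/
noncomputable abbrev IntermediateField.trdeg {k K : Type*} [Field k] [Field K] [Algebra k K]
    (E : IntermediateField k K) : Cardinal :=
  Algebra.trdeg k E

open scoped IntermediateField.algebraAdjoinAdjoin in
theorem IntermediateField.trdeg_adjoin (k : Type*) {K : Type*} [Field k] [Field K] [Algebra k K]
    (S : Set K) :
    (IntermediateField.adjoin k S).trdeg = Algebra.trdeg k (Algebra.adjoin k S) := by
  have : Algebra.IsAlgebraic (Algebra.adjoin k S) (IntermediateField.adjoin k S) :=
    IsLocalization.isAlgebraic _ (nonZeroDivisors (Algebra.adjoin k S))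
  have : FaithfulSMul (Algebra.adjoin k S) (IntermediateField.adjoin k S) :=
    IsFractionRing.instFaithfulSMul ..
  rw [trdeg, ← trdeg_add_eq k (Algebra.adjoin k S) (A := IntermediateField.adjoin k S),
    trdeg_eq_zero (R := Algebra.adjoin k S), add_zero]

theorem IntermediateField.trdeg_adjoin_union {k K : Type*} [Field k] [Field K] [Algebra k K]
    (S T : Set K) :
    (adjoin k S).trdeg + (adjoin (adjoin k S) T).trdeg = (adjoin k (S ∪ T)).trdeg := by
  rw [← adjoin_adjoin_left]
  exact trdeg_add_eq k (adjoin k S) (A := adjoin (adjoin k S) T)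

/-- The field `ℚ(a₁, exp a₁, …, aₙ, exp aₙ)`. -/
noncomputable abbrev expField {n : ℕ} (a : Fin n → ℂ) : IntermediateField ℚ ℂ :=
  IntermediateField.adjoin ℚ (Set.range (expPoint a))

theorem Fin.range_append {α : Type*} {n l : ℕ} (u : Fin n → α) (v : Fin l → α) :
    Set.range (Fin.append u v) = Set.range u ∪ Set.range v := by
  ext z
  constructor
  · rintro ⟨i, rfl⟩
    cases i using Fin.addCases <;> simp
  · rintro (⟨i, rfl⟩ | ⟨i, rfl⟩)
    exacts [⟨castAdd l i, append_left u v i⟩, ⟨natAdd n i, append_right u v i⟩]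

theorem range_expPoint_append {n l : ℕ} (a : Fin n → ℂ) (b : Fin l → ℂ) :
    Set.range (expPoint (Fin.append a b)) = Set.range (expPoint b) ∪ Set.range (expPoint a) := by
  have h : (fun i ↦ Complex.exp (Fin.append a b i)) =
      Fin.append (fun i ↦ Complex.exp (a i)) (fun i ↦ Complex.exp (b i)) := by
    ext i
    cases i using Fin.addCases <;> simp
  simp only [range_expPoint, h, Fin.range_append]
  ext z
  simp only [Set.mem_union]
  tauto

theorem exists_natCast_eq_trdeg_adjoin_range {k K σ : Type*} [Field k] [Field K] [Algebra k K]
    [Finite σ] (x : σ → K) :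
    ∃ s : ℕ, (IntermediateField.adjoin k (Set.range x)).trdeg = s ∧
      (s : WithBot ℕ∞) ≤ ringKrullDim (Algebra.adjoin k (Set.range x)) := by
  have : Algebra.FiniteType k (Algebra.adjoin k (Set.range x)) :=
    (Subalgebra.fg_iff_finiteType _).mp (Subalgebra.fg_def.mpr ⟨_, Set.finite_range x, rfl⟩)
  rw [IntermediateField.trdeg_adjoin]
  exact exists_natCast_eq_trdeg_and_le_ringKrullDim k _

theorem SchanuelConjecture.exists_trdeg_expField_eq (hSC : SchanuelConjecture) {n : ℕ}
    {a : Fin n → ℂ} (ha : LinearIndependent ℚ a) :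
    ∃ d : ℕ, (expField a).trdeg = (n + d : ℕ) := by
  obtain ⟨s, hs, -⟩ := exists_natCast_eq_trdeg_adjoin_range (k := ℚ) (expPoint a)
  have h : (n : Cardinal) ≤ (expField a).trdeg := by
    rw [expField, range_expPoint]
    convert! hSC n a ha
  rw [hs, Nat.cast_le] at h
  exact ⟨s - n, by rw [hs, Nat.add_sub_cancel' h]⟩

theorem span_range_subset_expField {n : ℕ} (a : Fin n → ℂ) :
    (Submodule.span ℚ (Set.range a) : Set ℂ) ⊆ expField a := by
  suffices h : Submodule.span ℚ (Set.range a) ≤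
      Subalgebra.toSubmodule (expField a).toSubalgebra from h
  rw [Submodule.span_le]
  exact (Set.subset_union_left.trans (range_expPoint a).superset).trans
    (IntermediateField.subset_adjoin ℚ _)

theorem exists_linearIndependent_subset_expField {C : Set ℂ} (hC : C.Finite) :
    ∃ (l : ℕ) (b : Fin l → ℂ), LinearIndependent ℚ b ∧ C ⊆ expField b := by
  have := FiniteDimensional.span_of_finite ℚ hC
  let b := Module.finBasis ℚ (Submodule.span ℚ C)
  refine ⟨_, fun i ↦ b i, b.linearIndependent.map' (Submodule.span ℚ C).subtype
    (Submodule.ker_subtype _), (Submodule.subset_span (R := ℚ) (s := C)).trans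
      (subset_trans ?_ (span_range_subset_expField _))⟩
  have h := congr_arg (Submodule.map (Submodule.span ℚ C).subtype) b.span_eq
  rw [Submodule.map_span, Submodule.map_top, Submodule.range_subtype, ← Set.range_comp] at h
  exact h.ge

/-- Any finite set of complex numbers is contained in a field `ℚ(b, exp b)` over which no
`ℚ`-linearly independent extension lowers the predimension. -/
theorem SchanuelConjecture.exists_strong_extension (hSC : SchanuelConjecture) {C : Set ℂ}
    (hC : C.Finite) :
    ∃ (l : ℕ) (b : Fin l → ℂ), LinearIndependent ℚ b ∧ C ⊆ expField b ∧
      ∀ (n : ℕ) (a : Fin n → ℂ), LinearIndependent ℚ (Fin.append a b) →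
        (n : Cardinal) ≤
          (IntermediateField.adjoin (expField b) (Set.range (expPoint a))).trdeg := by
  classical
  have hex : ∃ (d l : ℕ) (b : Fin l → ℂ), LinearIndependent ℚ b ∧ C ⊆ expField b ∧
      (expField b).trdeg = (l + d : ℕ) := by
    obtain ⟨l, b, hb, hCb⟩ := exists_linearIndependent_subset_expField hC
    obtain ⟨d, hd⟩ := hSC.exists_trdeg_expField_eq hb
    exact ⟨d, l, b, hb, hCb, hd⟩
  obtain ⟨l, b, hb, hCb, hd⟩ := Nat.find_spec hex
  refine ⟨l, b, hb, hCb, fun n a hab ↦ ?_⟩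
  obtain ⟨d, hd'⟩ := hSC.exists_trdeg_expField_eq hab
  have hle : expField b ≤ expField (Fin.append a b) := by
    rw [expField, expField, range_expPoint_append]
    exact IntermediateField.adjoin.mono _ _ _ Set.subset_union_left
  have hmin := Nat.find_min' hex ⟨n + l, Fin.append a b, hab, hCb.trans hle, hd'⟩
  obtain ⟨s, hs, -⟩ := exists_natCast_eq_trdeg_adjoin_range (k := expField b) (expPoint a)
  have hadd := IntermediateField.trdeg_adjoin_union (k := ℚ) (Set.range (expPoint b))
    (Set.range (expPoint a))
  rw [← range_expPoint_append, hd, hd', hs, ← Nat.cast_add, Nat.cast_inj] at hadd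
  rw [hs, Nat.cast_le]
  omega

/-- **SC implies SC with parameters:** assuming Schanuel's conjecture, for every ideal
`I` of `ℂ[X₁,…,X_{2n}]` whose quotient ring has Krull dimension less than `n`, there
are `l ∈ ℕ` and `b₁,…,b_l ∈ ℂ` such that whenever all polynomials of `I` vanish at
`(a₁, exp a₁, …, aₙ, exp aₙ)`, there are integers `m₁,…,m_{n+l}`, with `m₁,…,mₙ` not
all zero, such that `∑ mᵢ aᵢ + ∑ m_{n+i} bᵢ = 0`. -/
theorem sc_implies_sc_param (hSC : SchanuelConjecture)
    (n : ℕ) (I : Ideal (MvPolynomial (Fin (2 * n)) ℂ))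
    (hdim : ringKrullDim (MvPolynomial (Fin (2 * n)) ℂ ⧸ I) < n) :
    ∃ (l : ℕ) (b : Fin l → ℂ),
      ∀ a : Fin n → ℂ,
        (∀ p ∈ I, MvPolynomial.eval (expPoint a) p = 0) →
        ∃ (m : Fin n → ℤ) (m' : Fin l → ℤ), m ≠ 0 ∧
          (∑ i, m i • a i) + (∑ i, m' i • b i) = 0 := by
  obtain ⟨G, rfl⟩ : I.FG := IsNoetherian.noetherian I
  have hC : (⋃ g ∈ G, (g.coeffs : Set ℂ)).Finite :=
    G.finite_toSet.biUnion fun g _ ↦ g.coeffs.finite_toSet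
  obtain ⟨l, b, hb, hCb, hstrong⟩ := hSC.exists_strong_extension hC
  refine ⟨l, b, fun a ha ↦ ?_⟩
  by_contra! hno
  have hlow := hstrong n a (linearIndependent_append hb fun m m' hm ↦
    by_contra fun h ↦ hno m m' h hm)
  obtain ⟨s, hs, hsdim⟩ := exists_natCast_eq_trdeg_adjoin_range (k := expField b) (expPoint a)
  rw [hs, Nat.cast_le] at hlow
  let G' : Set (MvPolynomial (Fin (2 * n)) (expField b)) :=
    MvPolynomial.map (algebraMap (expField b) ℂ) ⁻¹' G
  have hG' : MvPolynomial.map (algebraMap (expField b) ℂ) '' G' = G := by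
    refine Set.image_preimage_eq_of_subset fun g hg ↦ ?_
    refine MvPolynomial.mem_range_map_iff_coeffs_subset.mpr fun c hc ↦ ?_
    exact ⟨⟨c, hCb (Set.mem_biUnion hg hc)⟩, rfl⟩
  have hup := ringKrullDim_adjoin_range_le G' (expPoint a) fun g hg ↦ by
    rw [MvPolynomial.aeval_def, MvPolynomial.eval₂_eq_eval_map]
    exact ha _ (Ideal.subset_span hg)
  rw [hG'] at hup
  have := (hsdim.trans hup).trans_lt hdim
  rw [Nat.cast_lt] at this
  omega
end

section
/- (Wilkie's theorem on generic real powers). Let r be a real number that is not exponentially algebraic in ℝ_exp, and let a₁,…,aₙ be positive real numbers. If the 2n real numbers a₁, a₁^r, …, aₙ, aₙ^r are multiplicatively independent, then trdeg_ℚ(a₁, a₁^r, …, aₙ, aₙ^r) ≥ n. -/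
set_option maxHeartbeats 1000000
set_option synthInstance.maxHeartbeats 400000

/-- Membership in the smallest subring of functions `ℝⁿ → ℝ` containing the
coordinate projections and closed under `f ↦ exp ∘ f` (real exponential polynomials). -/
inductive IsExpPolyR {n : ℕ} : ((Fin n → ℝ) → ℝ) → Prop
  | proj (i : Fin n) : IsExpPolyR fun x => x i
  | zero : IsExpPolyR 0
  | one : IsExpPolyR 1
  | neg {f} : IsExpPolyR f → IsExpPolyR (-f)
  | add {f g} : IsExpPolyR f → IsExpPolyR g → IsExpPolyR (f + g)
  | mul {f g} : IsExpPolyR f → IsExpPolyR g → IsExpPolyR (f * g)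
  | exp {f} : IsExpPolyR f → IsExpPolyR fun x => Real.exp (f x)

/-- A real number `γ` is exponentially algebraic in `ℝ_exp` iff there are `n ≥ 1`,
a point `a ∈ ℝⁿ` with first coordinate `γ`, and real exponential polynomials
`f₁,…,fₙ` vanishing at `a` whose Jacobian determinant at `a` is nonzero. -/
def ExpAlgebraicR (γ : ℝ) : Prop :=
  ∃ (n : ℕ) (hn : 0 < n) (a : Fin n → ℝ) (f : Fin n → (Fin n → ℝ) → ℝ),
    a ⟨0, hn⟩ = γ ∧ (∀ i, IsExpPolyR (f i)) ∧ (∀ i, f i a = 0) ∧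
    (Matrix.of fun i j => fderiv ℝ (f i) a (Pi.single j 1)).det ≠ 0

theorem Algebra.FormallySmooth.of_charZero (K L : Type*) [Field K] [Field L] [CharZero K]
    [Algebra K L] : Algebra.FormallySmooth K L := by
  obtain ⟨s, hs⟩ := exists_isTranscendenceBasis K L
  have := hs.isAlgebraic_field
  have : CharZero (IntermediateField.adjoin K (Set.range ((↑) : s → L))) :=
    charZero_of_injective_algebraMap
      (FaithfulSMul.algebraMap_injective K (IntermediateField.adjoin K (Set.range ((↑) : s → L))))
  exact .of_algebraicIndependent_of_isSeparable hs.1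

theorem Algebra.FormallySmooth.domain_field_of_charZero (A F : Type*) [CommRing A] [IsDomain A]
    [Field F] [CharZero F] [Algebra A F] [FaithfulSMul A F] : Algebra.FormallySmooth A F := by
  let := FractionRing.liftAlgebra A F
  have : CharZero (FractionRing A) := by
    refine ⟨fun m n h ↦ ?_⟩
    have := congrArg (algebraMap (FractionRing A) F) h
    simpa using this
  have := Algebra.FormallySmooth.of_charZero (FractionRing A) F
  have : Algebra.FormallySmooth A (FractionRing A) :=
    .of_isLocalization (nonZeroDivisors A)
  exact .comp A (FractionRing A) F

theorem Derivation.exists_extension {k A F : Type*} [CommRing k] [CommRing A] [IsDomain A]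
    [Field F] [CharZero F] [Algebra k A] [Algebra A F] [Algebra k F] [IsScalarTower k A F]
    [FaithfulSMul A F] (D : Derivation k A F) :
    ∃ D' : Derivation k F F, ∀ a, D' (algebraMap A F a) = D a := by
  have := Algebra.FormallySmooth.domain_field_of_charZero A F
  let φ : A →+* TrivSqZeroExt F F :=
    { toFun a := .inl (algebraMap A F a) + .inr (D a)
      map_one' := by ext <;> simp
      map_mul' a b := by
        ext
        · simp
        · simp only [map_mul, D.leibniz, TrivSqZeroExt.snd_mul, TrivSqZeroExt.snd_add,
            TrivSqZeroExt.snd_inl, TrivSqZeroExt.snd_inr, TrivSqZeroExt.fst_add,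
            TrivSqZeroExt.fst_inl, TrivSqZeroExt.fst_inr, algebra_compatible_smul F a,
            algebra_compatible_smul F b, smul_eq_mul, MulOpposite.smul_eq_mul_unop,
            MulOpposite.unop_op]
          ring
      map_zero' := by ext <;> simp
      map_add' a b := by ext <;> simp }
  let : Algebra A (TrivSqZeroExt F F) := φ.toAlgebra
  let g : TrivSqZeroExt F F →ₐ[A] F :=
    { (TrivSqZeroExt.fstHom F F F : TrivSqZeroExt F F →+* F) with
      commutes' a := by change (φ a).fst = _; simp [φ] }
  have hg : Function.Surjective g := fun x ↦ ⟨TrivSqZeroExt.inl x, rfl⟩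
  have hnil : IsNilpotent (RingHom.ker (g : TrivSqZeroExt F F →+* F)) := by
    refine ⟨2, ?_⟩
    rw [Submodule.pow_succ, Submodule.pow_one, Ideal.zero_eq_bot, eq_bot_iff, Ideal.mul_le]
    intro x hx y hy
    have hx' : x.fst = 0 := hx
    have hy' : y.fst = 0 := hy
    rw [Ideal.mem_bot]
    ext <;> simp [hx', hy']
  let s := Algebra.FormallySmooth.liftOfSurjective (AlgHom.id A F) g hg hnil
  have hs (x : F) : (s x).fst = x :=
    Algebra.FormallySmooth.liftOfSurjective_apply (AlgHom.id A F) g hg hnil x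
  have hsA (a : A) : s (algebraMap A F a) = φ a := s.commutes a
  have hsm (x y : F) : (s (x * y)).snd = x * (s y).snd + y * (s x).snd := by
    rw [map_mul, TrivSqZeroExt.snd_mul, hs, hs]
    simp [mul_comm]
  have hA (a : A) : (s (algebraMap A F a)).snd = D a := by simp [hsA, φ]
  refine ⟨Derivation.mk' { toFun x := (s x).snd, map_add' x y := by simp, map_smul' c x := ?_ }
    fun x y ↦ ?_, fun a ↦ hA a⟩
  · rw [Algebra.smul_def, hsm, IsScalarTower.algebraMap_apply k A F, hA]
    simp [Algebra.smul_def, ← IsScalarTower.algebraMap_apply k A F]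
  · exact hsm x y

section
open Differential

theorem Differential.exists_differentialAlgebra (K Ω : Type*) [Field K] [Field Ω] [CharZero Ω]
    [Algebra K Ω] [Differential K] : ∃ _ : Differential Ω, DifferentialAlgebra K Ω := by
  obtain ⟨D, hD⟩ := Derivation.exists_extension (k := ℤ) (A := K) (F := Ω)
    ((Algebra.linearMap K Ω).compDer Differential.deriv)
  let : Differential Ω := ⟨D⟩
  exact ⟨this, ⟨hD⟩⟩

variable {K L : Type*} [Field K] [CharZero K] [Field L] [Algebra K L] [FiniteDimensional K L]
  [Differential K] [Differential L] [DifferentialAlgebra K L]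

theorem Differential.trace_deriv (x : L) : Algebra.trace K L (x′) = (Algebra.trace K L x)′ := by
  have : CharZero (AlgebraicClosure K) :=
    charZero_of_injective_algebraMap (FaithfulSMul.algebraMap_injective K _)
  obtain ⟨_, _⟩ := Differential.exists_differentialAlgebra K (AlgebraicClosure K)
  apply FaithfulSMul.algebraMap_injective K (AlgebraicClosure K)
  simp_rw [← deriv_algebraMap, trace_eq_sum_embeddings, map_sum,
    fun σ : L →ₐ[K] AlgebraicClosure K ↦ algHom_deriv' σ σ.injective x]

theorem Differential.trace_logDeriv {x : L} (hx : x ≠ 0) :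
    Algebra.trace K L (logDeriv x) = logDeriv (Algebra.norm K x) := by
  have : CharZero (AlgebraicClosure K) :=
    charZero_of_injective_algebraMap (FaithfulSMul.algebraMap_injective K _)
  obtain ⟨_, _⟩ := Differential.exists_differentialAlgebra K (AlgebraicClosure K)
  apply FaithfulSMul.algebraMap_injective K (AlgebraicClosure K)
  rw [← logDeriv_algebraMap, trace_eq_sum_embeddings, Algebra.norm_eq_prod_embeddings,
    logDeriv_prod]
  · simp_rw [logDeriv, map_div₀,
      fun σ : L →ₐ[K] AlgebraicClosure K ↦ algHom_deriv' σ σ.injective x]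
  · intro σ _
    simpa using hx
end

open Polynomial in
/-- The elements of `E(t) ⊆ F` having a representation `p(t) / q(t)` with `q(0) ≠ 0`. -/
def regularAtZero (E : Type*) {F : Type*} [Field E] [Field F] [Algebra E F] (t : F) :
    Subalgebra E F where
  carrier := {x | ∃ p q : E[X], q.coeff 0 ≠ 0 ∧ x * aeval t q = aeval t p}
  mul_mem' := by
    rintro x y ⟨p, q, hq, hx⟩ ⟨p', q', hq', hy⟩
    refine ⟨p * p', q * q', by simp [hq, hq'], ?_⟩
    rw [map_mul, map_mul, ← hx, ← hy]
    ring
  add_mem' := by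
    rintro x y ⟨p, q, hq, hx⟩ ⟨p', q', hq', hy⟩
    refine ⟨p * q' + p' * q, q * q', by simp [hq, hq'], ?_⟩
    rw [map_add, map_mul, map_mul, map_mul, ← hx, ← hy]
    ring
  algebraMap_mem' c := ⟨C c, 1, by simp, by simp⟩

section
open Polynomial

variable {E F : Type*} [Field E] [Field F] [Algebra E F] {t : F}

theorem regularAtZero.self_mem : t ∈ regularAtZero E t := ⟨X, 1, by simp, by simp⟩

theorem aeval_ne_zero_of_transcendental (ht : Transcendental E t) {p : E[X]} (hp : p ≠ 0) :
    aeval t p ≠ 0 := fun h ↦ ht ⟨p, hp, h⟩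

theorem ne_zero_of_transcendental (ht : Transcendental E t) : t ≠ 0 := by
  simpa using aeval_ne_zero_of_transcendental ht X_ne_zero

theorem regularAtZero.deriv_mem {δ : Derivation E F F} (hδ : δ t = 1)
    {x : F} (hx : x ∈ regularAtZero E t) : δ x ∈ regularAtZero E t := by
  obtain ⟨p, q, hq, hx⟩ := hx
  refine ⟨derivative p * q - p * derivative q, q ^ 2, by simp [pow_two, hq], ?_⟩
  have h := congrArg δ hx
  simp only [Derivation.leibniz, Derivation.map_aeval, hδ, smul_eq_mul, mul_one] at h
  simp only [map_sub, map_mul, map_pow, ← hx]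
  linear_combination aeval t q * h

theorem regularAtZero.eq_zero_of_eq_mul (ht : Transcendental E t) {κ : E} {x : F}
    (hx : x ∈ regularAtZero E t) (h : algebraMap E F κ = t * x) : κ = 0 := by
  obtain ⟨p, q, hq, hx⟩ := hx
  have : aeval t (C κ * q - X * p) = 0 := by
    simp only [map_sub, map_mul, aeval_C, aeval_X, h, ← hx]
    ring
  have h0 : C κ * q - X * p = 0 := by
    by_contra h0
    exact aeval_ne_zero_of_transcendental ht h0 this
  have := congrArg (coeff · 0) h0
  simpa [hq] using this

theorem exists_eq_zpow_mul_of_mem_adjoin_simple (ht : Transcendental E t) {g : F}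
    (hg : g ∈ IntermediateField.adjoin E {t}) (hg0 : g ≠ 0) :
    ∃ (k : ℤ) (s : F), s ∈ regularAtZero E t ∧ s⁻¹ ∈ regularAtZero E t ∧ g = t ^ k * s := by
  obtain ⟨p, q, rfl⟩ := (IntermediateField.mem_adjoin_simple_iff _ _).1 hg
  have aux (p : E[X]) (hp : p ≠ 0) : ∃ (a : ℕ) (r : E[X]), r.coeff 0 ≠ 0 ∧ p = X ^ a * r := by
    obtain ⟨r, hr, hr'⟩ := exists_eq_pow_rootMultiplicity_mul_and_not_dvd p hp 0
    rw [C_0, sub_zero] at hr hr'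
    exact ⟨_, r, by rwa [Ne, ← X_dvd_iff], hr⟩
  have hp : p ≠ 0 := by rintro rfl; simp at hg0
  have hq : q ≠ 0 := by rintro rfl; simp at hg0
  obtain ⟨a, r, hr, rfl⟩ := aux p hp
  obtain ⟨b, r', hr', rfl⟩ := aux q hq
  have h1 := aeval_ne_zero_of_transcendental ht (p := r) (by rintro rfl; simp at hr)
  have h2 := aeval_ne_zero_of_transcendental ht (p := r') (by rintro rfl; simp at hr')
  refine ⟨a - b, aeval t r / aeval t r', ⟨r, r', hr', by field_simp⟩,
    ⟨r', r, hr, by field_simp⟩, ?_⟩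
  rw [zpow_sub₀ (ne_zero_of_transcendental ht)]
  simp only [map_mul, map_pow, aeval_X, zpow_natCast]
  field_simp [(ne_zero_of_transcendental ht)]

theorem Derivation.zpow_mul_div {R : Type*} [CommRing R] [Algebra R F] (δ : Derivation R F F)
    {x y : F} (hx : x ≠ 0) (hy : y ≠ 0) (k : ℤ) :
    δ (x ^ k * y) / (x ^ k * y) = k * (δ x / x) + δ y / y := by
  rw [δ.leibniz, δ.leibniz_zpow]
  have := zpow_ne_zero k hx
  simp only [smul_eq_mul, zsmul_eq_mul, zpow_sub_one₀ hx]
  field_simp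
  ring

theorem exists_residue_of_mem_adjoin_simple (ht : Transcendental E t) {δ : Derivation E F F}
    (hδ : δ t = 1) {g : F} (hg : g ∈ IntermediateField.adjoin E {t}) (hg0 : g ≠ 0) :
    ∃ (k : ℤ), ∃ u ∈ regularAtZero E t, t * (δ g / g) = k + t * u := by
  obtain ⟨k, s, hs, hs', rfl⟩ := exists_eq_zpow_mul_of_mem_adjoin_simple ht hg hg0
  refine ⟨k, δ s * s⁻¹, mul_mem (regularAtZero.deriv_mem hδ hs) hs', ?_⟩
  rw [δ.zpow_mul_div (ne_zero_of_transcendental ht) (right_ne_zero_of_mul hg0), hδ,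
    div_eq_mul_inv (δ s)]
  field_simp [(ne_zero_of_transcendental ht)]

theorem eq_zero_of_add_mul_eq_mul_deriv [CharZero F] (ht : Transcendental E t)
    {δ : Derivation E F F} (hδ : δ t = 1) {h : F} (hh : h ∈ IntermediateField.adjoin E {t})
    {κ : E} {u : F} (hu : u ∈ regularAtZero E t) (H : algebraMap E F κ + t * u = t * δ h) :
    κ = 0 := by
  have ht0 := (ne_zero_of_transcendental ht)
  by_cases h0 : h = 0
  · refine regularAtZero.eq_zero_of_eq_mul ht (neg_mem hu) ?_
    rw [h0, map_zero, mul_zero] at H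
    linear_combination H
  obtain ⟨k, s, hs, hs', rfl⟩ := exists_eq_zpow_mul_of_mem_adjoin_simple ht hh h0
  have hs0 := right_ne_zero_of_mul h0
  have hδs := regularAtZero.deriv_mem hδ hs
  have hder : t * δ (t ^ k * s) = t ^ k * (k * s + t * δ s) := by
    have := δ.zpow_mul_div ht0 hs0 k
    rw [div_eq_iff h0, hδ] at this
    rw [this]
    field_simp
  rw [hder] at H
  obtain ⟨n, rfl | rfl⟩ := k.eq_nat_or_neg
  · rcases n with _ | n
    · refine regularAtZero.eq_zero_of_eq_mul ht (sub_mem hδs hu) ?_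
      simp at H
      linear_combination H
    · refine regularAtZero.eq_zero_of_eq_mul ht (x := t ^ n * ((n + 1 : ℕ) * s + t * δ s) - u)
        (sub_mem (mul_mem (pow_mem regularAtZero.self_mem _)
          (add_mem (mul_mem (natCast_mem _ _) hs) (mul_mem regularAtZero.self_mem hδs))) hu) ?_
      rw [Int.cast_natCast, zpow_natCast, pow_succ] at H
      linear_combination H
  · rcases n with _ | n
    · refine regularAtZero.eq_zero_of_eq_mul ht (sub_mem hδs hu) ?_
      simp at H
      linear_combination H
    · exfalso
      have : ((n + 1 : ℕ) : E) = 0 := by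
        refine regularAtZero.eq_zero_of_eq_mul ht
          (x := (δ s - t ^ n * (algebraMap E F κ + t * u)) * s⁻¹)
          (mul_mem (sub_mem hδs (mul_mem (pow_mem regularAtZero.self_mem _)
          (add_mem (Subalgebra.algebraMap_mem _ _) (mul_mem regularAtZero.self_mem hu)))) hs') ?_
        rw [H]
        rw [zpow_neg, zpow_natCast, map_natCast, pow_succ]
        field_simp
        push_cast
        ring
      have : ((n + 1 : ℕ) : F) = 0 := by rw [← map_natCast (algebraMap E F), this, map_zero]
      exact Nat.cast_ne_zero.2 n.succ_ne_zero this
end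

section
open Polynomial

open scoped IntermediateField.algebraAdjoinAdjoin in
theorem exists_intermediateField_isAlgebraic_adjoin_simple {C F : Type*}
    [Field C] [Field F] [Algebra C F]
    {t : F} (ht : Transcendental C t) : ∃ E : IntermediateField C F, Transcendental E t ∧
      Algebra.IsAlgebraic (IntermediateField.adjoin E {t}) F := by
  obtain ⟨s, hts, hs⟩ := exists_isTranscendenceBasis_superset (R := C) (A := F) (s := {t})
    ((algebraicIndependent_unique_type_iff (ι := ({t} : Set F))).2 ht)
  have hst : insert t (s \ {t}) = s := by
    rw [Set.insert_sdiff_singleton, Set.insert_eq_of_mem (hts rfl)]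
  refine ⟨IntermediateField.adjoin C (s \ {t}), ?_, ?_⟩
  · have h := hs.1
    change AlgebraicIndepOn C id s at h
    rw [← hst] at h
    have := ((AlgebraicIndepOn.insert_iff (by simp)).1 h).2
    rw [Set.image_id] at this
    rw [Transcendental, ← IsFractionRing.isAlgebraic_iff (Algebra.adjoin C (s \ {t})) _ F]
    exact this
  · have := hs.isAlgebraic_field
    rw [Subtype.range_coe] at this
    have h2 : (IntermediateField.adjoin (IntermediateField.adjoin C (s \ {t})) {t}).restrictScalars C
        = IntermediateField.adjoin C s := by
      rw [IntermediateField.adjoin_adjoin_left, Set.union_singleton, hst]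
    rw [← h2] at this
    exact this

theorem Derivation.exists_apply_eq_one {E F : Type*} [Field E] [Field F] [CharZero F] [Algebra E F]
    {t : F} (ht : Transcendental E t) : ∃ δ : Derivation E F F, δ t = 1 := by
  let : Algebra E[X] F := (aeval t).toAlgebra
  have : IsScalarTower E E[X] F := .of_algebraMap_eq fun x ↦ by
    simp [RingHom.algebraMap_toAlgebra]
  have : FaithfulSMul E[X] F := by
    rw [faithfulSMul_iff_algebraMap_injective]
    exact transcendental_iff_injective.1 ht
  obtain ⟨δ, hδ⟩ := Derivation.exists_extension (mkDerivation E (1 : F))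
  refine ⟨δ, ?_⟩
  have := hδ X
  rwa [mkDerivation_X, RingHom.algebraMap_toAlgebra, AlgHom.toRingHom_eq_coe, RingHom.coe_coe,
    aeval_X] at this

theorem Derivation.prod_zpow_div {R F ι : Type*} [CommRing R] [Field F] [Algebra R F]
    (δ : Derivation R F F) (s : Finset ι) (w : ι → F) (hw : ∀ i, w i ≠ 0) (q : ι → ℤ) :
    δ (∏ i ∈ s, w i ^ q i) / ∏ i ∈ s, w i ^ q i = ∑ i ∈ s, q i * (δ (w i) / w i) := by
  classical
  induction s using Finset.induction_on with
  | empty => simp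
  | insert i s hi ih =>
    rw [Finset.prod_insert hi, Finset.sum_insert hi, ← ih, δ.zpow_mul_div (hw i)]
    exact Finset.prod_ne_zero_iff.2 fun j _ ↦ zpow_ne_zero _ (hw j)

end

open Differential in
theorem Differential.exists_norm_relation {K F ι : Type*} [Field K] [CharZero K] [Field F]
    [Algebra K F] [Algebra.IsAlgebraic K F] [Differential K] [Differential F]
    [DifferentialAlgebra K F] [Fintype ι] (w : ι → F) (hw : ∀ i, w i ≠ 0) (v : F) :
    ∃ (d : ℕ) (N : ι → K) (V : K), d ≠ 0 ∧ (∀ i, N i ≠ 0) ∧ ∀ (c : ι → K) (a b : K),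
      ∑ i, algebraMap K F (c i) * logDeriv (w i) = algebraMap K F a + algebraMap K F b * v′ →
        ∑ i, c i * logDeriv (N i) = d * a + b * V′ := by
  let L := IntermediateField.adjoin K (Set.range w ∪ {v})
  have : FiniteDimensional K L := IntermediateField.finiteDimensional_adjoin fun x _ ↦
    (Algebra.IsAlgebraic.isAlgebraic x).isIntegral
  let w' (i : ι) : L := ⟨w i, IntermediateField.subset_adjoin _ _ (.inl ⟨i, rfl⟩)⟩
  let v' : L := ⟨v, IntermediateField.subset_adjoin _ _ (.inr rfl)⟩
  have hw' (i : ι) : w' i ≠ 0 := fun h ↦ hw i (congrArg Subtype.val h)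
  refine ⟨Module.finrank K L, fun i ↦ Algebra.norm K (w' i), Algebra.trace K L v',
    Module.finrank_pos.ne', fun i ↦ Algebra.norm_ne_zero_iff.2 (hw' i), fun c a b h ↦ ?_⟩
  have h' : ∑ i, c i • logDeriv (w' i) = algebraMap K L a + b • v'′ := by
    apply FaithfulSMul.algebraMap_injective L F
    simp_rw [Algebra.smul_def, map_add, map_sum, map_mul, ← logDeriv_algebraMap,
      ← deriv_algebraMap, ← IsScalarTower.algebraMap_apply K L F]
    exact h
  have h'' := congrArg (Algebra.trace K L) h'
  simp_rw [map_add, map_sum, map_smul, Differential.trace_logDeriv (hw' _),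
    Algebra.trace_algebraMap, Differential.trace_deriv] at h''
  simpa using h''

theorem Derivation.mem_adjoin_simple {E F : Type*} [Field E] [Field F] [Algebra E F] {t : F}
    (δ : Derivation E F F) (hδ : δ t ∈ IntermediateField.adjoin E {t}) {x : F}
    (hx : x ∈ IntermediateField.adjoin E {t}) :
    δ x ∈ IntermediateField.adjoin E {t} := by
  obtain ⟨p, q, rfl⟩ := (IntermediateField.mem_adjoin_simple_iff _ _).1 hx
  have h (p : Polynomial E) : Polynomial.aeval t p ∈ IntermediateField.adjoin E {t} :=
    (IntermediateField.mem_adjoin_simple_iff _ _).2 ⟨p, 1, by simp⟩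
  rw [δ.leibniz_div, δ.map_aeval, δ.map_aeval]
  simp only [smul_eq_mul]
  exact mul_mem (pow_mem (inv_mem (h _)) _) (sub_mem (mul_mem (h _) (mul_mem (h _) hδ))
    (mul_mem (h _) (mul_mem (h _) hδ)))

theorem exists_int_relation_of_transcendental {C F ι : Type*} [Field C] [Field F] [CharZero F]
    [Algebra C F] [Fintype ι] {w : ι → F} (hw : ∀ i, w i ≠ 0) {v : F} {c : ι → C} {q : ι → ℤ}
    (ht : Transcendental C (∏ i, w i ^ q i))
    (h : ∀ δ : Derivation C F F, ∑ i, algebraMap C F (c i) * (δ (w i) / w i) = δ v) :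
    ∃ ρ : ι → ℤ, ∑ i, c i * ρ i = 0 ∧ ∑ i, q i * ρ i ≠ 0 := by
  obtain ⟨E, htE, halg⟩ := exists_intermediateField_isAlgebraic_adjoin_simple ht
  set t := ∏ i, w i ^ q i with ht_def
  obtain ⟨δ, hδ⟩ := Derivation.exists_apply_eq_one htE
  have ht0 := ne_zero_of_transcendental htE
  let K := IntermediateField.adjoin E {t}
  have : CharZero K := charZero_of_injective_algebraMap (algebraMap ℚ K).injective
  have hK (x : K) : δ x ∈ K := δ.mem_adjoin_simple (by rw [hδ]; exact one_mem _) x.2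
  let : Differential F := ⟨δ.restrictScalars ℤ⟩
  let : Differential K := ⟨Derivation.mk' ({ toFun x := ⟨δ x, hK x⟩
                                             map_add' x y := by ext; simp
                                             map_smul' m x := by ext; simp } : K →ₗ[ℤ] K)
    fun x y ↦ by ext; simp⟩
  have : DifferentialAlgebra K F := ⟨fun x ↦ rfl⟩
  obtain ⟨d, N, V, hd, hN, H⟩ := Differential.exists_norm_relation (K := K) w hw v
  have H1 := H (fun i ↦ algebraMap E K (algebraMap C E (c i))) 0 1 (by
    rw [map_zero, zero_add, map_one, one_mul]
    exact h (δ.restrictScalars C))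
  have tK : t ∈ K := IntermediateField.mem_adjoin_simple_self E t
  have H2 := H (fun i ↦ q i) (⟨t, tK⟩⁻¹) 0 (by
    have := δ.prod_zpow_div Finset.univ w hw q
    rw [← ht_def, hδ] at this
    rw [map_zero, zero_mul, add_zero, map_inv₀]
    simp_rw [map_intCast]
    exact this.symm.trans (one_div t))
  choose ρ u hu hρ using fun i ↦ exists_residue_of_mem_adjoin_simple htE hδ (N i).2
    (fun h ↦ hN i (Subtype.ext h))
  refine ⟨ρ, ?_, ?_⟩
  · have := eq_zero_of_add_mul_eq_mul_deriv htE hδ (h := V) V.2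
      (κ := ∑ i, algebraMap C E (c i) * ρ i) (u := ∑ i, algebraMap C F (c i) * u i) ?_ ?_
    · apply FaithfulSMul.algebraMap_injective C E
      simpa using this
    · exact sum_mem fun i _ ↦ mul_mem (Subalgebra.algebraMap_mem (regularAtZero E t)
        (algebraMap C E (c i))) (hu i)
    · have := congrArg (fun x : K ↦ t * (x : F)) H1
      simp only [mul_zero, zero_add, one_mul] at this
      refine Eq.trans ?_ this
      rw [AddSubmonoidClass.coe_finsetSum, Finset.mul_sum, map_sum, Finset.mul_sum,
        ← Finset.sum_add_distrib]
      refine Finset.sum_congr rfl fun i _ ↦ ?_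
      have := hρ i
      change _ = t * (algebraMap C F (c i) * (δ (N i) / N i))
      rw [map_mul, map_intCast, ← IsScalarTower.algebraMap_apply C E F]
      linear_combination - algebraMap C F (c i) * this
  · have := congrArg (fun x : K ↦ t * (x : F)) H2
    intro h0
    have key := regularAtZero.eq_zero_of_eq_mul htE (κ := (d : E)) (x := ∑ i, q i * u i)
      (sum_mem fun i _ ↦ mul_mem (intCast_mem _ _) (hu i)) ?_
    · have : CharZero E := charZero_of_injective_algebraMap (algebraMap ℚ E).injective
      exact hd (by exact_mod_cast key)
    · simp only [zero_mul, add_zero] at this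
      have h3 : t * ((d : F) * t⁻¹) = ∑ i, q i * (t * (δ (N i) / N i)) := by
        refine Eq.trans this.symm ?_
        rw [AddSubmonoidClass.coe_finsetSum, Finset.mul_sum]
        refine Finset.sum_congr rfl fun i _ ↦ ?_
        change t * ((q i : F) * (δ (N i) / N i)) = _
        ring
      simp_rw [hρ, mul_add, Finset.sum_add_distrib] at h3
      have h4 : ∑ i, (q i : F) * ρ i = 0 := by exact_mod_cast congrArg (Int.cast (R := F)) h0
      rw [h4, zero_add, mul_left_comm, mul_inv_cancel₀ ht0, mul_one] at h3
      rw [map_natCast, h3, Finset.mul_sum]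
      exact Finset.sum_congr rfl fun i _ ↦ by ring

section
variable {C F ι : Type*} [Field C] [Field F] [Algebra C F] [Fintype ι]

open Finset in
theorem Derivation.exists_constant_mem_of_stable [DecidableEq F] (D : Derivation C F F)
    (V : Submodule F (ι → F)) (hV : ∀ c ∈ V, (fun i ↦ D (c i)) ∈ V) (c : ι → F) (hc : c ∈ V)
    (hc0 : c ≠ 0) :
    ∃ c' ∈ V, c' ≠ 0 ∧ (∀ i, D (c' i) = 0) ∧ ∀ i, c i = 0 → c' i = 0 := by
  induction h : #{i | c i ≠ 0} using Nat.strong_induction_on generalizing c with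
  | h n ih =>
    obtain ⟨j, hj⟩ := Function.ne_iff.1 hc0
    rw [Pi.zero_apply] at hj
    have hc1 := V.smul_mem (c j)⁻¹ hc
    set c1 := (c j)⁻¹ • c with hc1_def
    have hc1j : c1 j = 1 := by simp [hc1_def, hj]
    have hc10 (i : ι) (hi : c i = 0) : c1 i = 0 := by simp [hc1_def, hi]
    by_cases hD : (fun i ↦ D (c1 i)) = 0
    · exact ⟨c1, hc1, fun h ↦ by simp [h] at hc1j, fun i ↦ congrFun hD i, hc10⟩
    · obtain ⟨c', h1, h2, h3, h4⟩ := ih _ (by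
        rw [← h]
        apply card_lt_card
        rw [ssubset_iff_of_subset]
        · exact ⟨j, by simpa using hj, by simp [hc1j]⟩
        · intro i
          simp only [mem_filter_univ]
          refine mt fun hi ↦ ?_
          rw [hc10 i hi, map_zero]) _ (hV c1 hc1) hD rfl
      exact ⟨c', h1, h2, h3, fun i hi ↦ h4 i (by rw [hc10 i hi, map_zero])⟩

open Finset in
theorem Derivation.le_span_constant_of_stable (D : Derivation C F F)
    (V : Submodule F (ι → F)) (hV : ∀ c ∈ V, (fun i ↦ D (c i)) ∈ V) :
    V ≤ Submodule.span F {c | c ∈ V ∧ ∀ i, D (c i) = 0} := by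
  classical
  intro c hc
  induction h : #{i | c i ≠ 0} using Nat.strong_induction_on generalizing c with
  | h n ih =>
    by_cases hc0 : c = 0
    · rw [hc0]
      exact zero_mem _
    obtain ⟨c', h1, h2, h3, h4⟩ := D.exists_constant_mem_of_stable V hV c hc hc0
    obtain ⟨j, hj⟩ := Function.ne_iff.1 h2
    rw [Pi.zero_apply] at hj
    have hc' := Submodule.smul_mem _ (c j / c' j) (Submodule.subset_span (R := F)
      (s := {c | c ∈ V ∧ ∀ i, D (c i) = 0}) ⟨h1, h3⟩)
    rw [← sub_add_cancel c ((c j / c' j) • c')]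
    refine add_mem (ih _ ?_ (sub_mem hc (V.smul_mem _ h1)) rfl) hc'
    rw [← h]
    apply card_lt_card
    rw [ssubset_iff_of_subset]
    · exact ⟨j, by simpa using mt (h4 j) hj, by simp [hj]⟩
    · intro i
      simp only [mem_filter_univ]
      refine mt fun hi ↦ ?_
      simp [hi, h4 i hi]

theorem Derivation.eq_zero_of_isAlgebraic [CharZero C] (D : Derivation C F F) {x : F}
    (hx : IsAlgebraic C x) : D x = 0 := by
  have h := D.map_aeval (minpoly C x) x
  rw [minpoly.aeval, map_zero, smul_eq_mul, zero_eq_mul] at h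
  refine h.resolve_left ?_
  exact (minpoly.irreducible hx.isIntegral).separable.aeval_derivative_ne_zero (minpoly.aeval _ _)

/-- The linear relations over `F` between the differential forms `dwᵢ / wᵢ - dzᵢ`. -/
def expRelations (C : Type*) {F ι : Type*} [Field C] [Field F] [Algebra C F] [Fintype ι]
    (w z : ι → F) : Submodule F (ι → F) where
  carrier := {c | ∀ δ : Derivation C F F, ∑ i, c i * (δ (w i) / w i - δ (z i)) = 0}
  add_mem' {c c'} h h' δ := by simp [add_mul, Finset.sum_add_distrib, h δ, h' δ]
  zero_mem' δ := by simp
  smul_mem' a c h δ := by simp [mul_assoc, ← Finset.mul_sum, h δ]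

theorem expRelations_stable {D : Derivation C F F} {w z : ι → F} (hw : ∀ i, w i ≠ 0)
    (hD : ∀ i, D (w i) = w i * D (z i)) {c : ι → F} (hc : c ∈ expRelations C w z) :
    (fun i ↦ D (c i)) ∈ expRelations C w z := by
  intro δ
  have h1 := congrArg D (hc δ)
  have h2 := hc ⁅D, δ⁆
  simp only [map_sum, Derivation.leibniz, map_zero, smul_eq_mul] at h1
  rw [← sub_eq_zero.2 (h1.trans h2.symm), ← Finset.sum_sub_distrib]
  refine Finset.sum_congr rfl fun i _ ↦ ?_
  have h3 : δ (D (w i)) = w i * δ (D (z i)) + D (z i) * δ (w i) := by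
    rw [hD, δ.leibniz, smul_eq_mul, smul_eq_mul]
  rw [map_sub, D.leibniz_div, Derivation.commutator_apply, Derivation.commutator_apply, h3, hD]
  have := hw i
  simp only [smul_eq_mul]
  field_simp
  ring

/-- A differential-field version of Ax's theorem: linear relations between the forms
`dwᵢ / wᵢ - dzᵢ` come from integral linear relations between the `zᵢ` modulo constants. -/
theorem expRelations_le_span [CharZero C] [CharZero F] {D : Derivation C F F}
    (hC : ∀ x, D x = 0 → x ∈ Set.range (algebraMap C F)) {w z : ι → F} (hw : ∀ i, w i ≠ 0)
    (hD : ∀ i, D (w i) = w i * D (z i)) :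
    expRelations C w z ≤ Submodule.span F
      {c | ∃ q : ι → ℤ, ∑ i, q i * D (z i) = 0 ∧ c = fun i ↦ (q i : F)} := by
  refine (D.le_span_constant_of_stable _ fun c ↦ expRelations_stable hw hD).trans ?_
  rw [Submodule.span_le]
  rintro c ⟨hc, hc0⟩
  choose γ hγ using fun i ↦ hC _ (hc0 i)
  let M := Submodule.span ℤ (Set.range γ)
  have : Module.Finite ℤ M := Module.Finite.span_of_finite ℤ (Set.finite_range γ)
  have : Module.Free ℤ M := Module.free_of_finite_type_torsion_free'
  let b := Module.finBasis ℤ M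
  let g (i : ι) : M := ⟨γ i, Submodule.subset_span ⟨i, rfl⟩⟩
  have hg (i : ι) : γ i = ∑ k, (b.repr (g i) k : C) * (b k : C) := by
    have := congrArg (Subtype.val) (b.sum_repr (g i))
    rw [AddSubmonoidClass.coe_finsetSum] at this
    simpa using this.symm
  have hb (m : _ → ℤ) (hm : ∑ k, (m k : C) * (b k : C) = 0) (k) : m k = 0 := by
    refine Fintype.linearIndependent_iff.1 b.linearIndependent m ?_ k
    apply Subtype.ext
    rw [AddSubmonoidClass.coe_finsetSum]
    simpa using hm
  have hq (k) : ∑ i, (b.repr (g i) k : F) * D (z i) = 0 := by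
    by_cases ht : Transcendental C (∏ i, w i ^ b.repr (g i) k)
    · exfalso
      obtain ⟨ρ, h1, h2⟩ := exists_int_relation_of_transcendental hw (v := ∑ i, c i * z i) ht
        (c := γ) (by
          intro δ
          have := hc δ
          simp_rw [mul_sub, Finset.sum_sub_distrib, sub_eq_zero] at this
          simp_rw [hγ, this, map_sum, ← hγ]
          simp)
      refine h2 (hb (fun k ↦ ∑ i, b.repr (g i) k * ρ i) ?_ k)
      rw [← h1]
      simp_rw [hg, Finset.sum_mul]
      push_cast
      simp_rw [Finset.sum_mul]
      rw [Finset.sum_comm]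
      exact Finset.sum_congr rfl fun i _ ↦ Finset.sum_congr rfl fun i _ ↦ by ring
    · have h := D.prod_zpow_div Finset.univ w hw fun i ↦ b.repr (g i) k
      rw [D.eq_zero_of_isAlgebraic (not_not.1 ht), zero_div] at h
      rw [h]
      refine Finset.sum_congr rfl fun i _ ↦ ?_
      rw [hD, mul_div_cancel_left₀ _ (hw i)]
  have : c = ∑ k, algebraMap C F (b k) • fun i ↦ (b.repr (g i) k : F) := by
    ext i
    rw [← hγ, hg]
    simp only [Finset.sum_apply, Pi.smul_apply, smul_eq_mul, map_sum, map_mul, map_intCast,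
      mul_comm]
  rw [this]
  exact sum_mem fun k _ ↦ Submodule.smul_mem _ _ (Submodule.subset_span ⟨_, hq k, rfl⟩)
end

open Set Matrix in
/-- A local `C¹` inverse lifts short segments in the target to curves in the source. -/
theorem exists_curve_of_det_ne_zero {ι : Type*} [Fintype ι] [DecidableEq ι]
    {f : (ι → ℝ) → ι → ℝ} {M : (ι → ℝ) → Matrix ι ι ℝ} (hf : ContDiff ℝ 1 f)
    (hM : ∀ z, HasFDerivAt f (LinearMap.toContinuousLinearMap (M z).mulVecLin) z)
    (hMc : Continuous M) {p : ι → ℝ} (hp : (M p).det ≠ 0) :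
    ∃ ε > 0, ∀ y : ι → ℝ, (∀ i, |f p i - y i| < ε) → ∃ γ : ℝ → ι → ℝ, γ 0 = p ∧ f (γ 1) = y ∧
      ∀ t ∈ Icc (0 : ℝ) 1, (M (γ t)).det ≠ 0 ∧ HasDerivAt γ ((M (γ t))⁻¹ *ᵥ (y - f p)) t := by
  let e (z : ι → ℝ) (hz : (M z).det ≠ 0) : (ι → ℝ) ≃L[ℝ] (ι → ℝ) :=
    (Matrix.toLin'OfInv (M := (M z)⁻¹) (M' := M z) (Matrix.nonsing_inv_mul _ hz.isUnit)
      (Matrix.mul_nonsing_inv _ hz.isUnit)).toContinuousLinearEquiv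
  have he (z) (hz : (M z).det ≠ 0) : HasFDerivAt f (e z hz : (ι → ℝ) →L[ℝ] (ι → ℝ)) z := by
    convert hM z using 1
    exact ContinuousLinearMap.ext fun v ↦ Matrix.toLin'_apply (M z) v
  let Φ := hf.contDiffAt.toOpenPartialHomeomorph f (he p hp) one_ne_zero
  have hΦp : p ∈ Φ.source := hf.contDiffAt.mem_toOpenPartialHomeomorph_source (he p hp) one_ne_zero
  have hΦ : ⇑Φ = f := rfl
  have hfp : f p ∈ Φ.target := Φ.map_source hΦp
  have hsymm : Φ.symm (f p) = p := Φ.left_inv hΦp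
  have hnear : ∀ᶠ y in nhds (f p), y ∈ Φ.target ∧ (M (Φ.symm y)).det ≠ 0 := by
    refine Filter.Eventually.and (Φ.open_target.mem_nhds hfp)
      (ContinuousAt.eventually_ne ?_ (by rwa [hsymm]))
    exact (hMc.matrix_det.continuousAt).comp (Φ.continuousAt_symm hfp)
  obtain ⟨ε, hε, hball⟩ := Metric.eventually_nhds_iff_ball.1 hnear
  refine ⟨ε, hε, fun y hy ↦ ?_⟩
  have hyball : y ∈ Metric.ball (f p) ε := by
    rw [Metric.mem_ball_comm, Metric.mem_ball, dist_pi_lt_iff hε]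
    exact hy
  have hseg (t : ℝ) (ht : t ∈ Icc (0 : ℝ) 1) : f p + t • (y - f p) ∈ Metric.ball (f p) ε :=
    (convex_ball _ _).add_smul_sub_mem (Metric.mem_ball_self hε) hyball ht
  refine ⟨fun t ↦ Φ.symm (f p + t • (y - f p)), by simp [hsymm], ?_, fun t ht ↦ ?_⟩
  · simp only [one_smul, add_sub_cancel]
    exact Φ.right_inv (hball y hyball).1
  · obtain ⟨h1, h2⟩ := hball _ (hseg t ht)
    refine ⟨h2, ?_⟩
    have h3 := Φ.hasFDerivAt_symm h1 (he _ h2)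
    have h4 : HasDerivAt (fun t : ℝ ↦ f p + t • (y - f p)) (y - f p) t := by
      simpa using ((hasDerivAt_id t).smul_const (y - f p)).const_add (f p)
    have h5 : (e _ h2).symm (y - f p) = (M (Φ.symm (f p + t • (y - f p))))⁻¹ *ᵥ (y - f p) :=
      Matrix.toLin'_apply _ _
    have h6 := h3.comp_hasDerivAt t h4
    rw [ContinuousLinearEquiv.coe_coe, h5] at h6
    exact h6

open Set Matrix in
theorem eq_zero_of_linear_ode {ι : Type*} [Fintype ι] {H : ℝ → ι → ℝ}
    {A : ℝ → Matrix ι ι ℝ} (hA : ContinuousOn A (Icc 0 1))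
    (hH : ∀ t ∈ Icc (0 : ℝ) 1, HasDerivAt H (A t *ᵥ H t) t) (h0 : H 0 = 0) :
    ∀ t ∈ Icc (0 : ℝ) 1, H t = 0 := by
  let : NormedAddCommGroup (Matrix ι ι ℝ) := Matrix.linftyOpNormedAddCommGroup
  have hA' : ContinuousOn (fun t ↦ ‖A t‖) (Icc 0 1) := by
    have : Continuous fun B : Matrix ι ι ℝ ↦ ‖B‖ := continuous_norm
    exact this.comp_continuousOn hA
  obtain ⟨K, hK⟩ := isCompact_Icc.exists_bound_of_continuousOn hA'
  refine eq_zero_of_abs_deriv_le_mul_abs_self_of_eq_zero_right (K := K)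
    (fun t ht ↦ (hH t ht).continuousAt.continuousWithinAt)
    (fun t ht ↦ (hH t (Ico_subset_Icc_self ht)).hasDerivWithinAt) h0 fun t ht ↦ ?_
  refine (Matrix.linfty_opNorm_mulVec _ _).trans ?_
  have := hK t (Ico_subset_Icc_self ht)
  rw [norm_norm] at this
  gcongr

theorem exists_linearIndependent_adapted {N : ℕ} (S : Set (Fin N → ℝ)) :
    ∃ G : Fin N → Fin N → ℝ, LinearIndependent ℝ G ∧
      (∀ i, G i ∈ S ∨ ∃ j, G i = Pi.single j 1) ∧
      S ⊆ Submodule.span ℝ (G '' {i | G i ∈ S}) := by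
  obtain ⟨b, hbS, hb, hbi⟩ := exists_linearIndependent ℝ S
  obtain ⟨b', hb', hbb', hsp, hi⟩ := exists_linearIndepOn_id_extension (K := ℝ) (s := b)
    (t := b ∪ Set.range fun j : Fin N ↦ (Pi.single j 1 : Fin N → ℝ)) hbi Set.subset_union_left
  have htop : (⊤ : Submodule ℝ (Fin N → ℝ)) ≤
      Submodule.span ℝ (Set.range ((↑) : b' → Fin N → ℝ)) := by
    rw [Subtype.range_coe, ← (Pi.basisFun ℝ (Fin N)).span_eq, Submodule.span_le]
    rintro _ ⟨j, rfl⟩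
    exact hsp (.inr ⟨j, by simp⟩)
  let B := Module.Basis.mk hi htop
  have : Fintype b' := FiniteDimensional.fintypeBasisIndex B
  have e : Fin N ≃ b' := (Fintype.equivFinOfCardEq (by
    rw [← Module.finrank_eq_card_basis B, Module.finrank_fin_fun])).symm
  refine ⟨fun i ↦ e i, hi.comp e e.injective, fun i ↦ ?_, fun x hx ↦ ?_⟩
  · rcases hb' (e i).2 with h | ⟨j, h⟩
    · exact .inl (hbS h)
    · exact .inr ⟨j, h.symm⟩
  · have hx' : x ∈ Submodule.span ℝ b := hb ▸ Submodule.subset_span hx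
    refine Submodule.span_mono (fun y hy ↦ ?_) hx'
    exact ⟨e.symm ⟨y, hbb' hy⟩, by simpa using hbS hy, by simp⟩

section
open MvPolynomial

theorem IsExpPolyR.intCast {n : ℕ} (m : ℤ) : IsExpPolyR (n := n) fun _ ↦ (m : ℝ) := by
  induction m using Int.induction_on with
  | zero =>
    simp only [Int.cast_zero]
    exact .zero
  | succ i h =>
    push_cast at h ⊢
    exact h.add .one
  | pred i h =>
    push_cast [sub_eq_add_neg] at h ⊢
    exact h.add IsExpPolyR.one.neg

variable {N : ℕ} {τ : Type*} {φ : τ → (Fin N → ℝ) → ℝ}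

theorem IsExpPolyR.mvPolynomial_aeval (h : ∀ s, IsExpPolyR (φ s)) (f : MvPolynomial τ ℤ) :
    IsExpPolyR fun z ↦ aeval (φ · z) f := by
  induction f using MvPolynomial.induction_on with
  | C m => simpa using IsExpPolyR.intCast m
  | add f g hf hg =>
    simp only [map_add]
    exact hf.add hg
  | mul_X f s hf =>
    simp only [map_mul, MvPolynomial.aeval_X]
    exact hf.mul (h s)

theorem ContDiff.mvPolynomial_aeval {E : Type*} [NormedAddCommGroup E] [NormedSpace ℝ E]
    {φ : τ → E → ℝ} {k : WithTop ℕ∞} (h : ∀ s, ContDiff ℝ k (φ s))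
    (f : MvPolynomial τ ℤ) : ContDiff ℝ k fun z ↦ aeval (φ · z) f := by
  induction f using MvPolynomial.induction_on with
  | C m => simpa using contDiff_const
  | add f g hf hg => simpa using hf.add hg
  | mul_X f s hf => simpa using hf.mul (h s)

theorem HasFDerivAt.mvPolynomial_aeval {dφ : Fin N → τ → MvPolynomial τ ℤ} {z : Fin N → ℝ}
    (h : ∀ s, HasFDerivAt (φ s) (∑ j, aeval (φ · z) (dφ j s) •
      (ContinuousLinearMap.proj j : (Fin N → ℝ) →L[ℝ] ℝ)) z)
    (f : MvPolynomial τ ℤ) : HasFDerivAt (fun z ↦ aeval (φ · z) f)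
      (∑ j, aeval (φ · z) (mkDerivation ℤ (dφ j) f) •
        (ContinuousLinearMap.proj j : (Fin N → ℝ) →L[ℝ] ℝ)) z := by
  induction f using MvPolynomial.induction_on with
  | C m => simpa using hasFDerivAt_const (m : ℝ) z
  | add f g hf hg =>
    simp only [map_add]
    refine (hf.add hg).congr_fderiv ?_
    simp only [add_smul, Finset.sum_add_distrib]
  | mul_X f s hf =>
    simp only [map_mul, aeval_X]
    refine (hf.mul (h s)).congr_fderiv ?_
    simp_rw [Derivation.leibniz, mkDerivation_X, smul_eq_mul, map_add, map_mul, aeval_X, add_smul,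
      Finset.sum_add_distrib, Finset.smul_sum, mul_smul]
end

section
open MvPolynomial Matrix Set

variable {N : ℕ} {τ : Type*} {φ : τ → (Fin N → ℝ) → ℝ} {dφ : Fin N → τ → MvPolynomial τ ℤ}

/-- The formal Jacobian matrix of a system of polynomials in the functions `φ`. -/
noncomputable def formalJacobian (dφ : Fin N → τ → MvPolynomial τ ℤ)
    (g : Fin N → MvPolynomial τ ℤ) : Matrix (Fin N) (Fin N) (MvPolynomial τ ℤ) :=
  .of fun i j ↦ mkDerivation ℤ (dφ j) (g i)

theorem hasFDerivAt_formalJacobian {z : Fin N → ℝ}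
    (hφ : ∀ s, HasFDerivAt (φ s) (∑ j, aeval (φ · z) (dφ j s) •
      (ContinuousLinearMap.proj j : (Fin N → ℝ) →L[ℝ] ℝ)) z) (g : Fin N → MvPolynomial τ ℤ) :
    HasFDerivAt (fun z i ↦ aeval (φ · z) (g i)) (LinearMap.toContinuousLinearMap
      ((aeval (φ · z)).mapMatrix (formalJacobian dφ g)).mulVecLin) z := by
  refine (hasFDerivAt_pi.2 fun i ↦ HasFDerivAt.mvPolynomial_aeval hφ (g i)).congr_fderiv ?_
  ext v i
  simp [formalJacobian, Matrix.mulVec, dotProduct]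

/-- If the gradients of the relations at `p` are spanned by the rows of the Jacobian of `g` which
come from relations, then moving along the other directions preserves all relations. -/
theorem aeval_eq_zero_along_curve [Finite τ]
    (hφc : ∀ s, ContDiff ℝ 1 (φ s))
    (hφ : ∀ s z, HasFDerivAt (φ s) (∑ j, aeval (φ · z) (dφ j s) •
      (ContinuousLinearMap.proj j : (Fin N → ℝ) →L[ℝ] ℝ)) z)
    {g : Fin N → MvPolynomial τ ℤ} {J : Finset (Fin N)} {p : Fin N → ℝ}
    (hp : ∀ f, aeval (φ · p) f = 0 → ∀ k ∈ J,
      aeval (φ · p) (∑ j, mkDerivation ℤ (dφ j) f * (formalJacobian dφ g).adjugate j k) = 0)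
    {γ : ℝ → Fin N → ℝ} {w : Fin N → ℝ} (hw : ∀ k, k ∉ J → w k = 0) (hγ0 : γ 0 = p)
    (hγ : ∀ t ∈ Icc (0 : ℝ) 1, ((aeval (φ · (γ t))).mapMatrix (formalJacobian dφ g)).det ≠ 0 ∧
      HasDerivAt γ (((aeval (φ · (γ t))).mapMatrix (formalJacobian dφ g))⁻¹ *ᵥ w) t)
    {f : MvPolynomial τ ℤ} (hf : aeval (φ · p) f = 0) :
    ∀ t ∈ Icc (0 : ℝ) 1, aeval (φ · (γ t)) f = 0 := by
  let I : Ideal (MvPolynomial τ ℤ) := RingHom.ker (aeval (φ · p))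
  obtain ⟨s, hs⟩ := (isNoetherianRing_iff_ideal_fg _).1 inferInstance I
  let Θ (k : Fin N) (f : MvPolynomial τ ℤ) : MvPolynomial τ ℤ :=
    ∑ j, mkDerivation ℤ (dφ j) f * (formalJacobian dφ g).adjugate j k
  have hder (f : MvPolynomial τ ℤ) (t : ℝ) (ht : t ∈ Icc (0 : ℝ) 1) :
      HasDerivAt (fun t ↦ aeval (φ · (γ t)) f)
        (((aeval (φ · (γ t))).mapMatrix (formalJacobian dφ g)).det⁻¹ *
          ∑ k ∈ J, w k * aeval (φ · (γ t)) (Θ k f)) t := by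
    obtain ⟨h1, h2⟩ := hγ t ht
    have h3 (j k) : aeval (φ · (γ t)) ((formalJacobian dφ g).adjugate j k) =
        ((aeval (φ · (γ t))).mapMatrix (formalJacobian dφ g)).adjugate j k := by
      rw [← AlgHom.map_adjugate, AlgHom.mapMatrix_apply, Matrix.map_apply]
    refine ((HasFDerivAt.mvPolynomial_aeval (hφ · (γ t)) f).comp_hasDerivAt t h2).congr_deriv ?_
    rw [Finset.sum_subset J.subset_univ fun k _ hk ↦ by rw [hw k hk, zero_mul]]
    simp only [Matrix.inv_def, Ring.inverse_eq_inv', Matrix.mulVec, h3,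
      dotProduct, Matrix.smul_apply, _root_.smul_eq_mul, _root_.sum_apply, _root_.smul_apply,
      ContinuousLinearMap.proj_apply, Θ, map_sum, map_mul, Finset.mul_sum]
    rw [Finset.sum_comm]
    exact Finset.sum_congr rfl fun i _ ↦ Finset.sum_congr rfl fun j _ ↦ by ring
  have hmem (h : s) (k : J) : ∃ c : s → MvPolynomial τ ℤ, ∑ b, c b * b = Θ k h := by
    have : Θ k h ∈ Ideal.span (s : Set (MvPolynomial τ ℤ)) := by
      rw [hs]
      refine hp _ ?_ k k.2
      change (h : MvPolynomial τ ℤ) ∈ I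
      rw [← hs]
      exact Submodule.subset_span h.2
    obtain ⟨c, hc⟩ := Submodule.mem_span_finset'.1 this
    exact ⟨c, hc⟩
  choose c hc using hmem
  have hγc : ContinuousOn γ (Icc 0 1) := fun t ht ↦ (hγ t ht).2.continuousAt.continuousWithinAt
  have hcont (f : MvPolynomial τ ℤ) : ContinuousOn (fun t ↦ aeval (φ · (γ t)) f) (Icc 0 1) :=
    (ContDiff.mvPolynomial_aeval hφc f).continuous.comp_continuousOn hγc
  have key := eq_zero_of_linear_ode (H := fun t (h : s) ↦ aeval (φ · (γ t)) (h : MvPolynomial τ ℤ))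
    (A := fun t ↦ .of fun h b ↦ (aeval (φ · (γ t)) (formalJacobian dφ g).det)⁻¹ *
      ∑ k : J, w k * aeval (φ · (γ t)) (c h k b)) ?_ ?_ ?_
  · intro t ht
    have : I ≤ RingHom.ker (aeval (φ · (γ t))) := by
      rw [← hs, Submodule.span_le]
      exact fun h hh ↦ congrFun (key t ht) ⟨h, hh⟩
    exact this hf
  · refine continuousOn_pi.2 fun h ↦ continuousOn_pi.2 fun b ↦ ?_
    refine ((hcont _).inv₀ fun t ht ↦ ?_).mul
      (continuousOn_finsetSum _ fun k _ ↦ continuousOn_const.mul (hcont _))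
    rw [AlgHom.map_det]
    exact (hγ t ht).1
  · refine fun t ht ↦ hasDerivAt_pi.2 fun h ↦ (hder h t ht).congr_deriv ?_
    rw [← Finset.sum_coe_sort]
    simp only [← hc, map_sum, map_mul, Matrix.mulVec, dotProduct, Matrix.of_apply, AlgHom.map_det,
      Finset.mul_sum, Finset.sum_mul]
    rw [Finset.sum_comm]
    exact Finset.sum_congr rfl fun i _ ↦ Finset.sum_congr rfl fun j _ ↦ by ring
  · ext h
    have : (h : MvPolynomial τ ℤ) ∈ I := hs ▸ Submodule.subset_span h.2
    rw [hγ0]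
    exact this

theorem expAlgebraicR_of_single_mem_span [Finite τ] (hN : 0 < N) {c : Fin N → τ}
    (hdc : ∀ k j, dφ k (c j) = if k = j then 1 else 0)
    (hE : ∀ s, IsExpPolyR (φ s)) (hφc : ∀ s, ContDiff ℝ 1 (φ s))
    (hφ : ∀ s z, HasFDerivAt (φ s) (∑ j, aeval (φ · z) (dφ j s) •
      (ContinuousLinearMap.proj j : (Fin N → ℝ) →L[ℝ] ℝ)) z) {p : Fin N → ℝ}
    (h : Pi.single ⟨0, hN⟩ 1 ∈ Submodule.span ℝ {G : Fin N → ℝ | ∃ f, aeval (φ · p) f = 0 ∧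
      G = fun j ↦ aeval (φ · p) (mkDerivation ℤ (dφ j) f)}) :
    ExpAlgebraicR (p ⟨0, hN⟩) := by
  classical
  set S : Set (Fin N → ℝ) := {G | ∃ f, aeval (φ · p) f = 0 ∧
      G = fun j ↦ aeval (φ · p) (mkDerivation ℤ (dφ j) f)} with hSdef
  obtain ⟨G, hGi, hGS, hS⟩ := exists_linearIndependent_adapted S
  have hex (i : Fin N) : ∃ f : MvPolynomial τ ℤ,
      G i = (fun j ↦ aeval (φ · p) (mkDerivation ℤ (dφ j) f)) ∧
        (G i ∈ S → aeval (φ · p) f = 0) := by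
    by_cases hi : G i ∈ S
    · obtain ⟨f, hf, hf'⟩ := hi
      exact ⟨f, hf', fun _ ↦ hf⟩
    · obtain ⟨j, hj⟩ := (hGS i).resolve_left hi
      refine ⟨X (c j), ?_, fun hi' ↦ (hi hi').elim⟩
      rw [hj]
      ext k
      by_cases hkj : k = j <;> simp [hdc, hkj]
  choose g hg hg0 using hex
  let M (z : Fin N → ℝ) : Matrix (Fin N) (Fin N) ℝ :=
    (aeval (φ · z)).mapMatrix (formalJacobian dφ g)
  have hMp : M p = .of G := by
    ext i j
    simp [M, formalJacobian, hg]
  have hdet : (M p).det ≠ 0 := by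
    rw [← isUnit_iff_ne_zero, ← Matrix.isUnit_iff_isUnit_det, hMp,
      ← Matrix.linearIndependent_rows_iff_isUnit]
    exact hGi
  have hadj (z j k) : aeval (φ · z) ((formalJacobian dφ g).adjugate j k) = (M z).adjugate j k := by
    rw [← AlgHom.map_adjugate, AlgHom.mapMatrix_apply, Matrix.map_apply]
  let J : Finset (Fin N) := {i | G i ∉ S}
  have hkill (v) (hv : v ∈ Submodule.span ℝ S) (k) (hk : k ∈ J) :
      ∑ j, v j * (M p).adjugate j k = 0 := by
    replace hv := Submodule.span_le.2 hS hv
    induction hv using Submodule.span_induction with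
    | mem v h =>
      obtain ⟨i, hi, rfl⟩ := h
      have h1 : ∑ j, G i j * (M p).adjugate j k = (M p * (M p).adjugate) i k := by
        rw [Matrix.mul_apply, hMp]
        rfl
      rw [h1, Matrix.mul_adjugate, Matrix.smul_apply, Matrix.one_apply_ne, smul_zero]
      rintro rfl
      exact (Finset.mem_filter.1 hk).2 hi
    | zero => simp
    | add v w _ _ hv hw => simp [add_mul, Finset.sum_add_distrib, hv, hw]
    | smul a v _ hv => simp [mul_assoc, ← Finset.mul_sum, hv]
  have hp (f) (hf : aeval (φ · p) f = 0) (k) (hk : k ∈ J) :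
      aeval (φ · p) (∑ j, mkDerivation ℤ (dφ j) f * (formalJacobian dφ g).adjugate j k) = 0 := by
    simp only [map_sum, map_mul, hadj]
    exact hkill _ (Submodule.subset_span ⟨f, hf, rfl⟩) k hk
  have hcol (k) (hk : k ∈ J) : aeval (φ · p) ((formalJacobian dφ g).adjugate ⟨0, hN⟩ k) = 0 := by
    rw [hadj]
    simpa [Pi.single_apply] using hkill _ h k hk
  have hM (z) : HasFDerivAt (fun z i ↦ aeval (φ · z) (g i))
      (LinearMap.toContinuousLinearMap (M z).mulVecLin) z :=
    hasFDerivAt_formalJacobian (hφ · z) g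
  obtain ⟨ε, hε, hcurve⟩ := exists_curve_of_det_ne_zero
    (contDiff_pi.2 fun i ↦ ContDiff.mvPolynomial_aeval hφc (g i)) hM
    (continuous_matrix fun i j ↦ (ContDiff.mvPolynomial_aeval hφc _).continuous) hdet
  have hq (i : Fin N) : ∃ q : ℚ, |aeval (φ · p) (g i) - q| < ε ∧
      (i ∉ J → aeval (φ · p) (g i) = q) := by
    by_cases hi : i ∈ J
    · obtain ⟨q, hq⟩ := exists_rat_near (aeval (φ · p) (g i)) hε
      exact ⟨q, hq, fun h ↦ (h hi).elim⟩
    · have : aeval (φ · p) (g i) = 0 := hg0 i (by simpa [J] using hi)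
      exact ⟨0, by simpa [this] using hε, by simp [this]⟩
  choose q hq hq' using hq
  obtain ⟨γ, hγ0, hγ1, hγ⟩ := hcurve (fun i ↦ q i) hq
  have hconst : γ 1 ⟨0, hN⟩ = p ⟨0, hN⟩ := by
    rw [← hγ0]
    refine constant_of_has_deriv_right_zero (f := fun t ↦ γ t ⟨0, hN⟩) (a := 0) (b := 1)
      (fun t ht ↦ ((hasDerivAt_pi.1 (hγ t ht).2) _).continuousAt.continuousWithinAt)
      (fun t ht ↦ ?_) 1 (by simp)
    have ht' := Ico_subset_Icc_self ht
    refine (((hasDerivAt_pi.1 (hγ t ht').2) _).congr_deriv ?_).hasDerivWithinAt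
    rw [Matrix.mulVec, dotProduct]
    refine Finset.sum_eq_zero fun k _ ↦ ?_
    by_cases hk : k ∈ J
    · rw [Matrix.inv_def, Matrix.smul_apply, ← hadj, aeval_eq_zero_along_curve hφc hφ hp
        (fun k hk ↦ ?_) hγ0 hγ (hcol k hk) t ht']
      · simp
      · simp [hq' k hk]
    · simp [hq' k hk]
  let F (i : Fin N) : MvPolynomial τ ℤ := C ((q i).den : ℤ) * g i - C (q i).num
  refine ⟨N, hN, γ 1, fun i z ↦ aeval (φ · z) (F i), hconst,
    fun i ↦ IsExpPolyR.mvPolynomial_aeval hE _, fun i ↦ ?_, ?_⟩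
  · have := congrFun hγ1 i
    simp only [F, map_sub, map_mul, MvPolynomial.aeval_C, this]
    have h : ((q i).den : ℝ) * q i = (q i).num := mod_cast Rat.den_mul_eq_num (q i)
    simp [h]
  · have : (Matrix.of fun i j ↦ fderiv ℝ (fun z ↦ aeval (φ · z) (F i)) (γ 1) (Pi.single j 1)) =
        Matrix.diagonal (fun i ↦ ((q i).den : ℝ)) * M (γ 1) := by
      ext i j
      rw [Matrix.of_apply, (HasFDerivAt.mvPolynomial_aeval (hφ · (γ 1)) (F i)).fderiv,
        Matrix.diagonal_mul]
      simp [F, M, formalJacobian, Pi.single_apply]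
    rw [this, Matrix.det_mul, Matrix.det_diagonal]
    exact mul_ne_zero (Finset.prod_ne_zero_iff.2 fun i _ ↦ by simp) (hγ 1 (by simp)).1

theorem exists_derivation_of_not_expAlgebraicR [Finite τ] (hN : 0 < N) {c : Fin N → τ}
    (hdc : ∀ k j, dφ k (c j) = if k = j then 1 else 0)
    (hE : ∀ s, IsExpPolyR (φ s)) (hφc : ∀ s, ContDiff ℝ 1 (φ s))
    (hφ : ∀ s z, HasFDerivAt (φ s) (∑ j, aeval (φ · z) (dφ j s) •
      (ContinuousLinearMap.proj j : (Fin N → ℝ) →L[ℝ] ℝ)) z) {p : Fin N → ℝ}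
    (h : ¬ ExpAlgebraicR (p ⟨0, hN⟩)) :
    ∃ (v : Fin N → ℝ) (D : Derivation ℤ ℝ ℝ), v ⟨0, hN⟩ = 1 ∧ ∀ f,
      D (aeval (φ · p) f) = ∑ j, v j * aeval (φ · p) (mkDerivation ℤ (dφ j) f) := by
  classical
  obtain ⟨l, hl, hlS⟩ := Submodule.exists_le_ker_of_notMem
    (mt (expAlgebraicR_of_single_mem_span hN hdc hE hφc hφ) h)
  let v (j : Fin N) : ℝ := (l (Pi.single ⟨0, hN⟩ 1))⁻¹ * l (Pi.single j 1)
  let L (f : MvPolynomial τ ℤ) : ℝ := ∑ j, v j * aeval (φ · p) (mkDerivation ℤ (dφ j) f)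
  have hL0 (f) (hf : aeval (φ · p) f = 0) : L f = 0 := by
    have h1 : l (fun j ↦ aeval (φ · p) (mkDerivation ℤ (dφ j) f)) = 0 :=
      hlS (Submodule.subset_span ⟨f, hf, rfl⟩)
    rw [LinearMap.pi_apply_eq_sum_univ] at h1
    simp only [L, v, mul_assoc, ← Finset.mul_sum]
    rw [mul_eq_zero]
    refine .inr (.trans (Finset.sum_congr rfl fun j _ ↦ ?_) h1)
    rw [smul_eq_mul, mul_comm]
    congr 2
    ext k
    simp [Pi.single_apply, eq_comm]
  have hLadd (f g) : L (f + g) = L f + L g := by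
    simp [L, mul_add, Finset.sum_add_distrib]
  have hLmul (f g) : L (f * g) = aeval (φ · p) f * L g + aeval (φ · p) g * L f := by
    simp only [L, Derivation.leibniz, smul_eq_mul, map_add, map_mul, mul_add,
      Finset.sum_add_distrib, Finset.mul_sum]
    congr 1 <;> exact Finset.sum_congr rfl fun j _ ↦ by ring
  have hLeq {f g} (hfg : aeval (φ · p) f = aeval (φ · p) g) : L f = L g := by
    have := hL0 (f - g) (by rw [map_sub, hfg, sub_self])
    have h2 := hLadd (f - g) g
    rw [sub_add_cancel, this, zero_add] at h2
    exact h2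
  let A : Subalgebra ℤ ℝ := (aeval (φ · p) : MvPolynomial τ ℤ →ₐ[ℤ] ℝ).range
  choose lift hlift using fun x : A ↦ x.2
  replace hlift (x : A) : aeval (φ · p) (lift x) = x := hlift x
  let D₀ : Derivation ℤ A ℝ := Derivation.mk'
    (AddMonoidHom.toIntLinearMap (AddMonoidHom.mk' (fun x : A ↦ L (lift x)) fun x y ↦ by
      rw [← hLadd]
      exact hLeq (by simp [hlift]))) fun x y ↦ by
      change L (lift (x * y)) = (x : ℝ) * L (lift y) + (y : ℝ) * L (lift x)
      rw [← hlift x, ← hlift y, ← hLmul]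
      exact hLeq (by simp [hlift])
  obtain ⟨D, hD⟩ := Derivation.exists_extension D₀
  refine ⟨v, D, inv_mul_cancel₀ hl, fun f ↦ ?_⟩
  exact (hD ⟨aeval (φ · p) f, f, rfl⟩).trans (hLeq (hlift _))

theorem exists_derivation_exp {r : ℝ} (hr : ¬ ExpAlgebraicR r) {n : ℕ} (x : Fin n → ℝ) :
    ∃ D : Derivation ℤ ℝ ℝ, D r = 1 ∧
      (∀ i, D (Real.exp (x i)) = Real.exp (x i) * D (x i)) ∧
      ∀ i, D (Real.exp (r * x i)) = Real.exp (r * x i) * D (r * x i) := by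
  let φ : Fin (n + 1) ⊕ Fin n ⊕ Fin n → (Fin (n + 1) → ℝ) → ℝ :=
    Sum.elim (fun j z ↦ z j)
      (Sum.elim (fun i z ↦ Real.exp (z i.succ)) (fun i z ↦ Real.exp (z 0 * z i.succ)))
  let dφ (k : Fin (n + 1)) :
      Fin (n + 1) ⊕ Fin n ⊕ Fin n → MvPolynomial (Fin (n + 1) ⊕ Fin n ⊕ Fin n) ℤ :=
    Sum.elim (fun j ↦ if k = j then 1 else 0)
      (Sum.elim (fun i ↦ if k = i.succ then X (.inr (.inl i)) else 0)
        (fun i ↦ (if k = 0 then X (.inr (.inr i)) * X (.inl i.succ) else 0) +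
          if k = i.succ then X (.inr (.inr i)) * X (.inl 0) else 0))
  have hite (z : Fin (n + 1) → ℝ) (q : Prop) [Decidable q] (f g : MvPolynomial _ ℤ) :
      aeval (φ · z) (if q then f else g) = if q then aeval (φ · z) f else aeval (φ · z) g :=
    apply_ite _ _ _ _
  have hφ₁ (j z) : φ (.inl j) z = z j := rfl
  have hφ₂ (i z) : φ (.inr (.inl i)) z = Real.exp (z i.succ) := rfl
  have hφ₃ (i z) : φ (.inr (.inr i)) z = Real.exp (z 0 * z i.succ) := rfl
  have hE : ∀ s, IsExpPolyR (φ s) := by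
    rintro (j | i | i)
    · exact .proj j
    · exact .exp (.proj i.succ)
    · exact .exp ((IsExpPolyR.proj 0).mul (.proj i.succ))
  have hφc : ∀ s, ContDiff ℝ 1 (φ s) := by
    rintro (j | i | i) <;> simp only [φ, Sum.elim_inl, Sum.elim_inr] <;> fun_prop
  have hφ : ∀ s z, HasFDerivAt (φ s) (∑ j, aeval (φ · z) (dφ j s) •
      (ContinuousLinearMap.proj j : (Fin (n + 1) → ℝ) →L[ℝ] ℝ)) z := by
    rintro (j | i | i) z
    · refine (hasFDerivAt_apply j z).congr_fderiv ?_
      ext u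
      simp [dφ, hite]
    · refine (hasFDerivAt_apply i.succ z).exp.congr_fderiv ?_
      ext u
      simp [dφ, hite, hφ₂]
    · refine ((hasFDerivAt_apply 0 z).mul (hasFDerivAt_apply i.succ z)).exp.congr_fderiv ?_
      ext u
      simp [dφ, hite, hφ₁, hφ₃, add_mul, Finset.sum_add_distrib]
      ring
  obtain ⟨v, D, hv, hD⟩ := exists_derivation_of_not_expAlgebraicR (φ := φ) (dφ := dφ)
    (Nat.succ_pos n) (c := Sum.inl) (p := Fin.cons r x) (fun k j ↦ rfl) hE hφc hφ hr
  have h0 : D r = v 0 := by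
    simpa [dφ, hite, hφ₁, hφ₂, hφ₃, mkDerivation_X] using hD (X (.inl 0))
  have hx (i) : D (x i) = v i.succ := by
    simpa [dφ, hite, hφ₁, hφ₂, hφ₃, mkDerivation_X] using hD (X (.inl i.succ))
  refine ⟨D, h0.trans hv, fun i ↦ ?_, fun i ↦ ?_⟩
  · rw [hx]
    simpa [dφ, hite, hφ₁, hφ₂, hφ₃, mkDerivation_X, mul_comm] using hD (X (.inr (.inl i)))
  · rw [Derivation.leibniz, hx, h0]
    have := hD (X (.inr (.inr i)))
    simp [dφ, hite, hφ₁, hφ₃, mkDerivation_X, mul_add, Finset.sum_add_distrib] at this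
    rw [this]
    simp only [smul_eq_mul]
    ring
end

section
open Polynomial Matrix

/-- A real linear dependence between vectors with coordinates in `ℤ[r]` yields one with
coefficients in `ℤ[r]`. -/
theorem exists_polynomial_relation {κ ι : Type*} [Fintype κ] [Fintype ι] {r : ℝ}
    (hr : Transcendental ℤ r) (P : Matrix κ ι ℤ[X])
    (h : ¬ LinearIndependent ℝ fun k i ↦ aeval r (P k i)) :
    ∃ p : κ → ℤ[X], p ≠ 0 ∧ ∀ i, ∑ k, aeval r (p k) * aeval r (P k i) = 0 := by
  classical
  let L : Matrix κ ι ℝ := P.map (aeval r)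
  have hL : (aeval r).mapMatrix (P * Pᵀ) = L * Lᵀ := by
    ext k l
    simp [L, Matrix.mul_apply]
  have hker (u : κ → ℝ) (hu : u ᵥ* (L * Lᵀ) = 0) : u ᵥ* L = 0 := by
    rw [← dotProduct_self_eq_zero, ← Matrix.mulVec_transpose L, Matrix.dotProduct_mulVec,
      Matrix.mulVec_transpose, Matrix.vecMul_vecMul, hu, zero_dotProduct]
  by_cases hdet : (P * Pᵀ).det = 0
  · obtain ⟨p, hp, hp'⟩ := Matrix.exists_vecMul_eq_zero_iff.2 hdet
    refine ⟨p, hp, congrFun (hker (fun k ↦ aeval r (p k)) ?_)⟩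
    rw [← hL]
    ext k
    simpa [Matrix.vecMul, dotProduct] using congrArg (aeval r) (congrFun hp' k)
  · refine (h ((Matrix.vecMul_injective_iff (M := L)).1 fun u v huv ↦ ?_)).elim
    have hdet' : (L * Lᵀ).det ≠ 0 := by
      rw [← hL, ← AlgHom.map_det]
      exact (map_ne_zero_iff _ (transcendental_iff_injective.1 hr)).2 hdet
    have : (u - v) ᵥ* (L * Lᵀ) = 0 := by
      rw [← Matrix.vecMul_vecMul, Matrix.sub_vecMul, show u ᵥ* L = v ᵥ* L from huv,
        sub_self, Matrix.zero_vecMul]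
    exact sub_eq_zero.1 (Matrix.eq_zero_of_vecMul_eq_zero hdet' this)

theorem Submodule.finrank_sup_range_add_finrank_comap_le {K U V : Type*} [Field K]
    [AddCommGroup U] [Module K U] [AddCommGroup V] [Module K V] [FiniteDimensional K U]
    (S : Submodule K V) [FiniteDimensional K S] (T : U →ₗ[K] V) :
    Module.finrank K ↥(S ⊔ T.range) + Module.finrank K ↥(S.comap T) ≤
      Module.finrank K S + Module.finrank K U := by
  have h := (S.subtype.coprod T).finrank_range_add_finrank_ker
  rw [LinearMap.range_coprod, Submodule.range_subtype, Module.finrank_prod] at h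
  rw [← h]
  gcongr
  let f : S.comap T →ₗ[K] (S.subtype.coprod T).ker :=
    ((-T.restrict fun _ h ↦ h : S.comap T →ₗ[K] S).prod (S.comap T).subtype).codRestrict _
      fun u ↦ by simp
  exact LinearMap.finrank_le_finrank_of_injective (f := f) fun u v huv ↦
    Subtype.ext (congrArg (fun y : (S.subtype.coprod T).ker ↦ (y : S × U).2) huv)

end

namespace Derivation
variable {R F : Type*} [CommRing R] [Field F] [Algebra R F]

/-- The field of constants of a derivation of a field. -/
def constants (D : Derivation R F F) : Subfield F where
  carrier := {x | D x = 0}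
  mul_mem' {x y} hx hy := by simp_all
  one_mem' := D.map_one_eq_zero
  add_mem' {x y} hx hy := by simp_all
  zero_mem' := D.map_zero
  neg_mem' {x} hx := by simp_all
  inv_mem' x hx := by simp_all [Derivation.leibniz_inv]

/-- A derivation of a field is linear over its field of constants. -/
def overConstants (D : Derivation R F F) : Derivation D.constants F F :=
  .mk' { toFun := D
         map_add' := D.map_add
         map_smul' := fun c x ↦ by
          have : D c = 0 := c.2
          simp [Subfield.smul_def, this] } fun x y ↦ D.leibniz x y

@[simp]
theorem overConstants_apply (D : Derivation R F F) (x : F) : D.overConstants x = D x := rfl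

/-- Evaluation of derivations at an element, as a linear form. -/
def evalDual (C : Type*) [CommRing C] [Algebra C F] (x : F) :
    Module.Dual F (Derivation C F F) where
  toFun δ := δ x
  map_add' _ _ := rfl
  map_smul' _ _ := rfl

@[simp]
theorem evalDual_apply {C : Type*} [CommRing C] [Algebra C F] (x : F) (δ : Derivation C F F) :
    evalDual C x δ = δ x := rfl

theorem eq_zero_of_isAlgebraic_of_eq_zero [CharZero F] {A : Type*} [CommRing A]
    [Algebra A F] [FaithfulSMul A F]
    (D : Derivation R F F) (hA : ∀ a : A, D (algebraMap A F a) = 0) {x : F}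
    (hx : IsAlgebraic A x) : D x = 0 := by
  let _ := ((algebraMap A F).codRestrict D.constants hA).toAlgebra
  have : IsScalarTower A D.constants F := .of_algebraMap_eq fun _ ↦ rfl
  have : IsAlgebraic D.constants x := hx.extendScalars fun a b hab ↦
    FaithfulSMul.algebraMap_injective A F (congrArg Subtype.val hab)
  exact D.overConstants.eq_zero_of_isAlgebraic this

end Derivation

section
open Polynomial Module Derivation

/-- Integer relations between the derivatives of `x i` and `r * x i` that are linearly independent
remain so after being contracted along `(m, m') ↦ m + r m'`. -/
theorem linearIndependent_contract {κ : Type*} [Fintype κ] {n : ℕ} {C : Subfield ℝ} {r : ℝ}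
    (hr : Transcendental C r) {x : Fin n → ℝ}
    (hx : ∀ m m' : Fin n → ℤ, ∑ i, (m i + r * m' i) * x i = 0 → m = 0 ∧ m' = 0)
    {q : κ → Fin n ⊕ Fin n → ℤ} (hq : LinearIndependent ℝ fun k i ↦ (q k i : ℝ))
    (hC : ∀ k, ∑ i, (q k (.inl i) + r * q k (.inr i)) * x i ∈ C) :
    LinearIndependent ℝ fun k i ↦ (q k (.inl i) + r * q k (.inr i) : ℝ) := by
  by_contra h
  obtain ⟨p, hp, hp'⟩ := exists_polynomial_relation (r := r) (fun ⟨P, hP, h⟩ ↦ hr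
      ⟨P.map (algebraMap ℤ C), (Polynomial.map_ne_zero_iff (algebraMap ℤ C).injective_int).2 hP,
        by rw [aeval_map_algebraMap]; exact h⟩)
    (.of fun k i ↦ (Polynomial.C (q k (.inl i)) + X * Polynomial.C (q k (.inr i))))
    (by simpa using h)
  let c (k : κ) : C := ⟨_, hC k⟩
  have hc (k) : (c k : ℝ) = ∑ i, (q k (.inl i) + r * q k (.inr i)) * x i := rfl
  have hzero : ∑ k, (p k).map (algebraMap ℤ C) * Polynomial.C (c k) = 0 := by
    refine (transcendental_iff.1 hr) _ ?_
    simp only [map_sum, map_mul, aeval_map_algebraMap, aeval_C]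
    change ∑ k, aeval r (p k) * (c k : ℝ) = 0
    simp only [hc, Finset.mul_sum]
    rw [Finset.sum_comm]
    refine Finset.sum_eq_zero fun i _ ↦ ?_
    have := congrArg (· * x i) (hp' i)
    simpa [Finset.sum_mul, mul_assoc] using this
  refine hp (funext fun l ↦ Polynomial.ext fun j ↦ ?_)
  have hj : ∑ k, ((p k).coeff j : ℝ) * c k = 0 := by
    simpa [finsetSum_coeff] using congrArg (fun P ↦ ((P.coeff j : C) : ℝ)) hzero
  have h0 := hx (fun i ↦ ∑ k, (p k).coeff j * q k (.inl i))
    (fun i ↦ ∑ k, (p k).coeff j * q k (.inr i)) ?_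
  · rw [Fintype.linearIndependent_iff] at hq
    have := hq (fun k ↦ (p k).coeff j) ?_ l
    · exact_mod_cast this
    · ext (i | i)
      · simpa using mod_cast congrFun h0.1 i
      · simpa using mod_cast congrFun h0.2 i
  · rw [← hj]
    simp only [hc, Finset.mul_sum, Int.cast_sum, Int.cast_mul, ← Finset.sum_add_distrib,
      Finset.sum_mul]
    rw [Finset.sum_comm]
    exact Finset.sum_congr rfl fun k _ ↦ Finset.sum_congr rfl fun i _ ↦ by ring

theorem card_le_of_derivation {n : ℕ} {D : Derivation ℤ ℝ ℝ} {r : ℝ} (hr : D r = 1)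
    {x : Fin n → ℝ} (hD : ∀ i, D (Real.exp (x i)) = Real.exp (x i) * D (x i))
    (hD' : ∀ i, D (Real.exp (r * x i)) = Real.exp (r * x i) * D (r * x i))
    (hx : ∀ m m' : Fin n → ℤ, ∑ i, (m i + r * m' i) * x i = 0 → m = 0 ∧ m' = 0)
    {σ : Type*} [Fintype σ] {β : σ → ℝ}
    (hβ : ∀ δ : Derivation D.constants ℝ ℝ, (∀ j, δ (β j) = 0) →
      ∀ i, δ (Real.exp (x i)) = 0 ∧ δ (Real.exp (r * x i)) = 0) :
    n ≤ Fintype.card σ := by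
  let C := D.constants
  let d : ℝ → Dual ℝ (Derivation C ℝ ℝ) := evalDual C
  let w : Fin n ⊕ Fin n → ℝ := Sum.elim (fun i ↦ Real.exp (x i)) fun i ↦ Real.exp (r * x i)
  let z : Fin n ⊕ Fin n → ℝ := Sum.elim x fun i ↦ r * x i
  have hw (i) : w i ≠ 0 := by rcases i with i | i <;> exact Real.exp_ne_zero _
  have hDw (i) : D.overConstants (w i) = w i * D.overConstants (z i) := by
    rcases i with i | i
    · exact hD i
    · exact hD' i
  let ω (i : Fin n ⊕ Fin n) : Dual ℝ (Derivation C ℝ ℝ) := (w i)⁻¹ • d (w i) - d (z i)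
  let A : (Fin n ⊕ Fin n → ℝ) →ₗ[ℝ] Dual ℝ (Derivation C ℝ ℝ) := Fintype.linearCombination ℝ ω
  let T : (Fin n → ℝ) →ₗ[ℝ] Dual ℝ (Derivation C ℝ ℝ) :=
    Fintype.linearCombination ℝ fun i ↦ d (x i)
  let b : Option σ → Dual ℝ (Derivation C ℝ ℝ) := fun j ↦ j.elim (d r) (d ∘ β)
  let S : Submodule ℝ (Dual ℝ (Derivation C ℝ ℝ)) := Submodule.span ℝ (Set.range b)
  have hrS : d r ∈ S := Submodule.subset_span ⟨none, rfl⟩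
  have hrC : Transcendental C r := fun h ↦ by
    have := D.overConstants.eq_zero_of_isAlgebraic h
    simp [hr] at this
  have hwS (i) : d (w i) ∈ S := by
    have : d (w i) ∈ Submodule.span ℝ (Set.range (d ∘ β)) := by
      refine mem_span_of_iInf_ker_le_ker fun δ hδ ↦ ?_
      have hδ' : ∀ j, δ (β j) = 0 := by simpa [d] using hδ
      rcases i with i | i
      · exact (hβ δ hδ' i).1
      · exact (hβ δ hδ' i).2
    refine Submodule.span_mono ?_ this
    rintro _ ⟨j, rfl⟩
    exact ⟨some j, rfl⟩
  have hxT (i) : d (x i) ∈ T.range := by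
    classical
    exact ⟨Pi.single i 1, by simp [T]⟩
  have hrx (i) : d (r * x i) = r • d (x i) + x i • d r := by
    ext δ
    simp [d]
  have hωS (i) : ω i ∈ S ⊔ T.range := by
    refine sub_mem (Submodule.smul_mem _ _ (Submodule.mem_sup_left (hwS i))) ?_
    rcases i with i | i
    · exact Submodule.mem_sup_right (hxT i)
    · change d (r * x i) ∈ _
      rw [hrx]
      exact add_mem (Submodule.smul_mem _ _ (Submodule.mem_sup_right (hxT i)))
        (Submodule.smul_mem _ _ (Submodule.mem_sup_left hrS))
  have hAlt : A.range < S ⊔ T.range := by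
    refine lt_of_le_of_ne ?_ fun h ↦ ?_
    · rw [Fintype.range_linearCombination, Submodule.span_le]
      rintro _ ⟨i, rfl⟩
      exact hωS i
    · have h1 : d r ∈ A.range := h ▸ Submodule.mem_sup_left hrS
      obtain ⟨c, hc⟩ := h1
      have := congrArg (fun l ↦ l D.overConstants) hc
      have h0 (i) : ω i D.overConstants = 0 := by
        simp only [ω, d, LinearMap.sub_apply, LinearMap.smul_apply, evalDual_apply, hDw,
          smul_eq_mul]
        rw [inv_mul_cancel_left₀ (hw i), sub_self]
      simp only [A, Fintype.linearCombination_apply, LinearMap.sum_apply, LinearMap.smul_apply, h0,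
        smul_zero, Finset.sum_const_zero] at this
      exact zero_ne_one (this.trans hr)
  have hker : A.ker = expRelations C w z := by
    ext c
    change A c = 0 ↔ ∀ δ : Derivation C ℝ ℝ, _
    rw [LinearMap.ext_iff]
    refine forall_congr' fun δ ↦ ?_
    simp [A, Fintype.linearCombination_apply, ω, d, div_eq_inv_mul]
  have : FiniteDimensional ℝ S := .span_of_finite ℝ (Set.finite_range b)
  have h1 := Submodule.finrank_lt_finrank_of_lt hAlt
  have h2 := S.finrank_sup_range_add_finrank_comap_le T
  have h3 := A.finrank_range_add_finrank_ker
  have h4 : finrank ℝ S ≤ Fintype.card σ + 1 := by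
    simpa [Set.finrank] using finrank_range_le_card (R := ℝ) b
  have h5 : finrank ℝ A.ker ≤ finrank ℝ (S.comap T) := by
    rw [hker]
    have hsp := expRelations_le_span (C := C) (D := D.overConstants)
      (fun x hx ↦ ⟨⟨x, hx⟩, rfl⟩) hw hDw
    refine (Submodule.finrank_mono hsp).trans ?_
    obtain ⟨B, hB, hBs, hBi⟩ := exists_linearIndependent ℝ
      {c | ∃ q : Fin n ⊕ Fin n → ℤ, ∑ i, q i * D.overConstants (z i) = 0 ∧ c = fun i ↦ (q i : ℝ)}
    rw [← hBs]
    have := hBi.finite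
    have := Fintype.ofFinite B
    choose q hq hq' using fun k : B ↦ hB k.2
    have hsum (δ : Derivation C ℝ ℝ) (k : B) : ∑ i, q k i * δ (z i) =
        δ (∑ i, (q k (.inl i) + r * q k (.inr i)) * x i) := by
      rw [Fintype.sum_sum_type, ← Finset.sum_add_distrib, map_sum]
      simp only [z, Sum.elim_inl, Sum.elim_inr, Derivation.leibniz, map_add,
        Derivation.map_intCast, smul_eq_mul, mul_zero, zero_add]
      exact Finset.sum_congr rfl fun i _ ↦ by ring
    have hqC (k) : ∑ i, (q k (.inl i) + r * q k (.inr i)) * x i ∈ C :=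
      (hsum D.overConstants k).symm.trans (hq k)
    have hqB : (Subtype.val : B → _) = fun k i ↦ (q k i : ℝ) := funext hq'
    have hℓ := linearIndependent_contract hrC hx (q := q) (by rwa [hqB] at hBi) hqC
    have hmem (k : B) : (fun i ↦ (q k (.inl i) + r * q k (.inr i) : ℝ)) ∈ S.comap T := by
      have : T (fun i ↦ (q k (.inl i) + r * q k (.inr i) : ℝ)) =
          (-∑ i, q k (.inr i) * x i) • d r := by
        ext δ
        have h0 := hsum δ k
        rw [show δ (∑ i, (q k (.inl i) + r * q k (.inr i)) * x i) = 0 from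
          δ.map_algebraMap (⟨_, hqC k⟩ : C)] at h0
        simp only [T, d, Fintype.linearCombination_apply, LinearMap.sum_apply,
          LinearMap.smul_apply, evalDual_apply, smul_eq_mul]
        rw [neg_mul, ← add_eq_zero_iff_eq_neg, Finset.sum_mul, ← Finset.sum_add_distrib, ← h0,
          Fintype.sum_sum_type, ← Finset.sum_add_distrib]
        refine Finset.sum_congr rfl fun i _ ↦ ?_
        simp only [z, Sum.elim_inl, Sum.elim_inr, Derivation.leibniz, smul_eq_mul]
        ring
      rw [Submodule.mem_comap, this]
      exact Submodule.smul_mem _ _ hrS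
    have hfin : finrank ℝ (Submodule.span ℝ B) = Fintype.card B := by
      rw [finrank_span_set_eq_card hBi, Set.toFinset_card]
    rw [hfin]
    let v (k : B) : S.comap T := ⟨_, hmem k⟩
    exact (LinearIndependent.of_comp (S.comap T).subtype (v := v) hℓ).fintype_card_le_finrank
  simp only [finrank_fintype_fun_eq_card, Fintype.card_sum, Fintype.card_fin] at h2 h3
  omega
end

/-- **Wilkie's theorem on generic real powers.** If `r` is a real number that is not
exponentially algebraic in `ℝ_exp` and `a₁,…,aₙ` are positive reals such that
`a₁, a₁^r, …, aₙ, aₙ^r` are multiplicatively independent, then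
`trdeg_ℚ(a₁, a₁^r, …, aₙ, aₙ^r) ≥ n`. -/
theorem wilkie_generic_real_powers
    (r : ℝ) (hr : ¬ ExpAlgebraicR r) (n : ℕ) (a : Fin n → ℝ)
    (hpos : ∀ i, 0 < a i)
    (hmi : ∀ m m' : Fin n → ℤ,
      (∏ i, a i ^ m i) * (∏ i, (a i ^ r) ^ m' i) = 1 → m = 0 ∧ m' = 0) :
    (n : Cardinal) ≤ trdeg ℚ (IntermediateField.adjoin ℚ
      (Set.range a ∪ Set.range fun i => a i ^ r)) := by
  let x (i : Fin n) : ℝ := Real.log (a i)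
  have hax (i) : Real.exp (x i) = a i := Real.exp_log (hpos i)
  have hax' (i) : Real.exp (r * x i) = a i ^ r := by
    rw [Real.rpow_def_of_pos (hpos i), mul_comm]
  obtain ⟨D, hDr, hD, hD'⟩ := exists_derivation_exp hr x
  have hx (m m' : Fin n → ℤ) (h : ∑ i, (m i + r * m' i) * x i = 0) : m = 0 ∧ m' = 0 := by
    refine hmi m m' ?_
    have h₁ (i) : a i ^ m i = Real.exp (m i * x i) := by
      rw [← hax, ← Real.rpow_intCast, ← Real.exp_mul, mul_comm]
    have h₂ (i) : (a i ^ r) ^ m' i = Real.exp (m' i * (r * x i)) := by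
      rw [← hax', ← Real.rpow_intCast, ← Real.exp_mul, mul_comm]
    simp only [h₁, h₂]
    rw [← Finset.prod_mul_distrib]
    simp only [← Real.exp_add]
    rw [← Real.exp_sum, Real.exp_eq_one_iff, ← h]
    exact Finset.sum_congr rfl fun i _ ↦ by ring
  set K := IntermediateField.adjoin ℚ (Set.range a ∪ Set.range fun i => a i ^ r)
  obtain ⟨s, hs⟩ := exists_isTranscendenceBasis ℚ K
  have hle : Cardinal.mk s ≤ trdeg ℚ K :=
    le_ciSup (f := fun s : { s : Set K // AlgebraicIndependent ℚ ((↑) : s → K) } ↦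
      Cardinal.mk s.1) Cardinal.bddAbove_of_small ⟨s, hs.1⟩
  refine le_trans ?_ hle
  by_contra! hlt
  have : Fintype s :=
    (Cardinal.lt_aleph0_iff_fintype.1 (hlt.trans Cardinal.natCast_lt_aleph0)).some
  rw [Cardinal.mk_fintype, Nat.cast_lt] at hlt
  have halg := hs.isAlgebraic
  refine hlt.not_ge (card_le_of_derivation hDr hD hD' hx (β := fun j : s ↦ ((j : K) : ℝ)) ?_)
  intro δ hδ
  have hK (y : K) : δ (y : ℝ) = 0 := by
    refine δ.eq_zero_of_isAlgebraic_of_eq_zero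
      (A := Algebra.adjoin ℚ (Set.range ((↑) : s → K))) (fun c ↦ ?_)
      ((halg.isAlgebraic y).algebraMap)
    change δ ((c : K) : ℝ) = 0
    obtain ⟨c, hc⟩ := c
    induction hc using Algebra.adjoin_induction with
    | mem y h =>
      obtain ⟨j, rfl⟩ := h
      exact hδ j
    | algebraMap q =>
      have : ((algebraMap ℚ K q : K) : ℝ) = algebraMap D.constants ℝ q := by simp
      rw [this, δ.map_algebraMap]
    | add y z _ _ hy hz => simp_all
    | mul y z _ _ hy hz => simp_all
  intro i
  rw [hax, hax']
  exact ⟨hK ⟨a i, IntermediateField.subset_adjoin _ _ (.inl ⟨i, rfl⟩)⟩,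
    hK ⟨a i ^ r, IntermediateField.subset_adjoin _ _ (.inr ⟨i, rfl⟩)⟩⟩
end
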